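/- arXiv:1810.01818 — 4 statements merged into one kernel-verified Lean document; each statement's English description precedes it below -/
import Mathlib

section
/- Let k be a finite field, R a split local Frobenius k-algebra, Q = (I, E, s, t) a finite quiver, and α : I → ℕ a rank vector such that k contains a primitive |α|-th root of unity, where |α| = Σ_{i∈I} α(i). Then a_α(Π_R(Q)) = a_α(R[ε]Q): the number of G_α(R)-orbits of absolutely indecomposable representations of the double quiver Q̄ lying in the zero fibre μ_R^{-1}(0) of the moment map equals the number of G_α(R[ε])-orbits of absolutely indecomposable representations in Rep^α(Q, R[ε]), where R[ε] = R[ε]/(ε²) is the algebra of dual numbers over R. -/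
open Matrix

/-- The space of locally free representations of rank `α` of the quiver with vertex set `I`,
arrow set `E`, source map `s` and target map `t`, over the commutative ring `S`. -/
abbrev QRep (I E : Type) (s t : E → I) (α : I → ℕ) (S : Type) [CommRing S] : Type :=
  ∀ a : E, Matrix (Fin (α (t a))) (Fin (α (s a))) S

/-- The group `G_α(S) = ∏_i GL_{α i}(S)`. -/
abbrev QGl (I : Type) (α : I → ℕ) (S : Type) [CommRing S] : Type :=
  ∀ i : I, (Matrix (Fin (α i)) (Fin (α i)) S)ˣ

/-- The action of `G_α(S)` on representations: `(g • M)_a = g_{t a} * M_a * g_{s a}⁻¹`. -/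
def QAct {I E : Type} (s t : E → I) (α : I → ℕ) {S : Type} [CommRing S]
    (g : QGl I α S) (M : QRep I E s t α S) : QRep I E s t α S :=
  fun a => (g (t a)).val * M a * (g (s a)).inv

/-- A representation is decomposable if, after acting by some `g ∈ G_α(S)`, it is
simultaneously block-diagonal with respect to a nontrivial splitting `α = β + γ`. -/
def QDecomposable {I E : Type} (s t : E → I) (α : I → ℕ) (S : Type) [CommRing S]
    (M : QRep I E s t α S) : Prop :=
  ∃ β γ : I → ℕ, (∀ i, β i + γ i = α i) ∧ β ≠ 0 ∧ γ ≠ 0 ∧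
    ∃ g : QGl I α S, ∀ (a : E) (r : Fin (α (t a))) (c : Fin (α (s a))),
      (((r : ℕ) < β (t a) ∧ β (s a) ≤ (c : ℕ)) ∨ (β (t a) ≤ (r : ℕ) ∧ (c : ℕ) < β (s a))) →
      QAct s t α g M a r c = 0

/-- A representation over the `k`-algebra `R` is absolutely indecomposable if its entrywise
base change to `R ⊗_k k̄`, for `k̄` an algebraic closure of `k`, is indecomposable. -/
def QAbsInd (k : Type) [Field k] {I E : Type} (s t : E → I) (α : I → ℕ)
    (R : Type) [CommRing R] [Algebra k R] (M : QRep I E s t α R) : Prop :=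
  ¬ QDecomposable s t α (TensorProduct k R (AlgebraicClosure k))
      (fun a => (M a).map ⇑(algebraMap R (TensorProduct k R (AlgebraicClosure k))))

/-- `a_α(RQ)`: the number of `G_α(R)`-orbits of absolutely indecomposable representations. -/
noncomputable def aOrbits (k : Type) [Field k] (I E : Type) (s t : E → I) (α : I → ℕ)
    (R : Type) [CommRing R] [Algebra k R] : ℕ :=
  Nat.card {O : Set (QRep I E s t α R) //
    ∃ M : QRep I E s t α R, QAbsInd k s t α R M ∧
      O = {N | ∃ g : QGl I α R, N = QAct s t α g M}}

/-- The `i`-th component of the moment map on representations of the double quiver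
`Q̄` (arrow set `E ⊕ E`, the second copy consisting of the reversed arrows):
`μ(N)_i = Σ_{a : t a = i} N_a N_{a*} − Σ_{a : s a = i} N_{a*} N_a`. -/
noncomputable def momentMapD (I E : Type) [DecidableEq I] [Fintype E] (s t : E → I)
    (α : I → ℕ) (S : Type) [CommRing S]
    (N : QRep I (E ⊕ E) (Sum.elim s t) (Sum.elim t s) α S) (i : I) :
    Matrix (Fin (α i)) (Fin (α i)) S :=
  (∑ a : E, if h : t a = i then
      ((show Matrix (Fin (α (t a))) (Fin (α (s a))) S from N (Sum.inl a)) *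
        (show Matrix (Fin (α (s a))) (Fin (α (t a))) S from N (Sum.inr a))).submatrix
        (finCongr (congrArg α h.symm)) (finCongr (congrArg α h.symm))
    else 0)
  - ∑ a : E, if h : s a = i then
      ((show Matrix (Fin (α (s a))) (Fin (α (t a))) S from N (Sum.inr a)) *
        (show Matrix (Fin (α (t a))) (Fin (α (s a))) S from N (Sum.inl a))).submatrix
        (finCongr (congrArg α h.symm)) (finCongr (congrArg α h.symm))
    else 0

/-- `a_α(Π_R(Q))`: the number of `G_α(R)`-orbits of absolutely indecomposable
representations of the double quiver lying in the zero fibre of the moment map. -/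
noncomputable def aOrbitsPreproj (k : Type) [Field k] (I E : Type) [DecidableEq I] [Fintype E]
    (s t : E → I) (α : I → ℕ) (R : Type) [CommRing R] [Algebra k R] : ℕ :=
  Nat.card {O : Set (QRep I (E ⊕ E) (Sum.elim s t) (Sum.elim t s) α R) //
    ∃ N : QRep I (E ⊕ E) (Sum.elim s t) (Sum.elim t s) α R,
      (∀ i : I, momentMapD I E s t α R N i = 0) ∧
      QAbsInd k (Sum.elim s t) (Sum.elim t s) α R N ∧
      O = {N' | ∃ g : QGl I α R, N' = QAct (Sum.elim s t) (Sum.elim t s) α g N}}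

open Polynomial in
theorem det_aeval_eq_prod_roots_charpoly {K : Type*} [Field K] [IsAlgClosed K] {n : ℕ}
    (x : Matrix (Fin n) (Fin n) K) (p : K[X]) :
    (aeval x p).det = (x.charpoly.roots.map fun μ => p.eval μ).prod := by
  have hsplit := IsAlgClosed.splits x.charpoly
  have hcard : x.charpoly.roots.card = n := by
    rw [← hsplit.natDegree_eq_card_roots, charpoly_natDegree_eq_dim, Fintype.card_fin]
  have hC : ∀ c : K, (aeval x (C c)).det = (x.charpoly.roots.map fun μ => (C c).eval μ).prod := by
    intro c
    simp [hcard, Algebra.algebraMap_eq_smul_one]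
  have hX : ∀ c : K, (aeval x (X - C c)).det =
      (x.charpoly.roots.map fun μ => (X - C c).eval μ).prod := by
    intro c
    have h1 : x.charpoly.eval c = (Matrix.scalar (Fin n) c - x).det := eval_charpoly x c
    rw [hsplit.eval_eq_prod_roots_of_monic x.charpoly_monic] at h1
    have h2 : aeval x (X - C c) = -(Matrix.scalar (Fin n) c - x) := by
      simp [Matrix.algebraMap_eq_diagonal, Matrix.scalar_apply]
    have h3 := Multiset.prod_map_neg (x.charpoly.roots.map fun a => c - a)
    rw [Multiset.card_map, hcard, Multiset.map_map] at h3
    rw [h2, det_neg, ← h1, Fintype.card_fin, ← h3]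
    simp
  have hmul : ∀ p q : K[X], (aeval x p).det = (x.charpoly.roots.map fun μ => p.eval μ).prod →
      (aeval x q).det = (x.charpoly.roots.map fun μ => q.eval μ).prod →
      (aeval x (p * q)).det = (x.charpoly.roots.map fun μ => (p * q).eval μ).prod := by
    intro p q hp hq
    simp only [map_mul, det_mul, hp, hq, eval_mul, Multiset.prod_map_mul]
  rw [(IsAlgClosed.splits p).eq_prod_roots]
  refine hmul _ _ (hC _) ?_
  induction p.roots using Multiset.induction_on with
  | empty => simp
  | cons a s ih =>
    rw [Multiset.map_cons, Multiset.prod_cons]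
    exact hmul _ _ (hX a) ih

open Polynomial in
theorem algebraMap_det_aeval {k K : Type*} [Field k] [Field K] [Algebra k K] [IsAlgClosed K]
    {n : ℕ} (x : Matrix (Fin n) (Fin n) k) (p : k[X]) :
    algebraMap k K (aeval x p).det =
      ((x.charpoly.map (algebraMap k K)).roots.map fun μ => aeval μ p).prod := by
  have h := det_aeval_eq_prod_roots_charpoly (x.map (algebraMap k K)) (p.map (algebraMap k K))
  rw [Matrix.charpoly_map] at h
  simp only [eval_map_algebraMap] at h
  rw [← h, RingHom.map_det]
  congr 1
  rw [aeval_map_algebraMap]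
  exact (aeval_algHom_apply ((Algebra.ofId k K).mapMatrix (m := Fin n)) x p).symm

open Polynomial in
theorem exists_prod_roots_aeval_eq {k K : Type*} [Field k] [Finite k] [Field K] [Algebra k K]
    [IsAlgClosed K] (f : k[X]) (hf : f.Monic) (hirr : Irreducible f) (c : k) :
    ∃ u : k[X], algebraMap k K c =
      ((f.map (algebraMap k K)).roots.map fun μ => aeval μ u).prod := by
  have : Fact (Irreducible f) := ⟨hirr⟩
  let pb := AdjoinRoot.powerBasis hf.ne_zero
  have : Module.Finite k (AdjoinRoot f) := pb.finite
  have : Finite (AdjoinRoot f) := Module.finite_of_finite k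
  obtain ⟨z, hz⟩ := FiniteField.norm_surjective k (AdjoinRoot f) c
  obtain ⟨u, rfl⟩ := AdjoinRoot.mk_surjective z
  refine ⟨u, ?_⟩
  rw [← hz, Algebra.norm_eq_matrix_det pb.basis, ← AdjoinRoot.aeval_eq,
    ← aeval_algHom_apply, algebraMap_det_aeval]
  have h := charpoly_leftMulMatrix pb
  rw [AdjoinRoot.minpoly_powerBasis_gen_of_monic hf] at h
  have hchar : (Algebra.leftMulMatrix pb.basis (AdjoinRoot.root f)).charpoly = f := h
  rw [hchar]

/-- The algebra `∏ i, Mat_{α i}(S)`. -/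
abbrev QMat (I : Type) (α : I → ℕ) (S : Type) [CommRing S] : Type :=
  ∀ i : I, Matrix (Fin (α i)) (Fin (α i)) S

/-- The product of the determinants of the components. -/
def piDet {I : Type} [Fintype I] {α : I → ℕ} {S : Type} [CommRing S] (x : QMat I α S) : S :=
  ∏ i, (x i).det

/-- The product of the characteristic polynomials of the components. -/
noncomputable def piCharpoly {I : Type} [Fintype I] {α : I → ℕ} {S : Type} [CommRing S]
    (x : QMat I α S) : Polynomial S :=
  ∏ i, (x i).charpoly

section
open Polynomial
variable {I : Type} [Fintype I] {α : I → ℕ} {S : Type} [CommRing S]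

theorem piDet_mul (x y : QMat I α S) : piDet (x * y) = piDet x * piDet y := by
  simp [piDet, Finset.prod_mul_distrib]

theorem piDet_one : piDet (1 : QMat I α S) = 1 := by
  simp [piDet]

theorem isUnit_of_isUnit_piDet {x : QMat I α S} (h : IsUnit (piDet x)) : IsUnit x := by
  rw [Pi.isUnit_iff]
  intro i
  rw [Matrix.isUnit_iff_isUnit_det]
  exact isUnit_of_dvd_unit (Finset.dvd_prod_of_mem (fun i => (x i).det) (Finset.mem_univ i)) h

theorem piCharpoly_monic (x : QMat I α S) : (piCharpoly x).Monic :=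
  monic_prod_of_monic _ _ fun i _ => (x i).charpoly_monic

theorem piCharpoly_natDegree [Nontrivial S] (x : QMat I α S) :
    (piCharpoly x).natDegree = ∑ i, α i := by
  rw [piCharpoly, natDegree_prod_of_monic _ _ fun i _ => (x i).charpoly_monic]
  simp

theorem aeval_self_piCharpoly (x : QMat I α S) : aeval x (piCharpoly x) = 0 := by
  funext i
  rw [Polynomial.aeval_pi_apply, piCharpoly]
  change aeval (x i) _ = 0
  obtain ⟨q, hq⟩ := Finset.dvd_prod_of_mem (fun i => (x i).charpoly) (Finset.mem_univ i)
  rw [hq, map_mul, Matrix.aeval_self_charpoly, zero_mul]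

end

open Polynomial in
theorem algebraMap_piDet_aeval {I : Type} [Fintype I] {α : I → ℕ} {k K : Type} [Field k] [Field K]
    [Algebra k K] [IsAlgClosed K] (x : QMat I α k) (p : k[X]) :
    algebraMap k K (piDet (aeval x p)) =
      (((piCharpoly x).map (algebraMap k K)).roots.map fun μ => aeval μ p).prod := by
  rw [piDet, map_prod, piCharpoly, Polynomial.map_prod, roots_prod]
  · rw [Multiset.map_bind, Multiset.prod_bind]
    refine Finset.prod_congr rfl fun i _ => ?_
    rw [Polynomial.aeval_pi_apply, algebraMap_det_aeval]
  · rw [Finset.prod_ne_zero_iff]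
    intro i _
    exact ((x i).charpoly_monic.map _).ne_zero

open Polynomial in
/-- If every unit of a matrix subalgebra over a finite field has determinant killed by a character
of order the total size, then every element has a single eigenvalue. -/
theorem exists_isNilpotent_sub_algebraMap {I : Type} [Fintype I] {α : I → ℕ} {k : Type} [Field k]
    [Finite k] (ψ : k → ℂ) (hψ : ∀ (c : k) (m : ℕ), ψ (c ^ m) = ψ c ^ m)
    (hn : 0 < ∑ i, α i) (c : k) (hc0 : c ≠ 0) (hc : ∀ m, 0 < m → m < ∑ i, α i → ψ c ^ m ≠ 1)
    (B : Subalgebra k (QMat I α k)) (hB : ∀ x ∈ B, piDet x ≠ 0 → ψ (piDet x) = 1)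
    (x : QMat I α k) (hx : x ∈ B) :
    ∃ a : k, IsNilpotent (x - algebraMap k (QMat I α k) a) := by
  let K := AlgebraicClosure k
  have hFm := piCharpoly_monic x
  have hFd := piCharpoly_natDegree x
  set F := piCharpoly x with hF
  obtain ⟨f, hfm, hfirr, hfF⟩ := exists_monic_irreducible_factor F (by
    intro h
    have := natDegree_eq_zero_of_isUnit h
    omega)
  have hfin : FiniteMultiplicity f F :=
    finiteMultiplicity_of_degree_pos_of_monic hfirr.degree_pos hfm hFm.ne_zero
  obtain ⟨h, hFh, hfh⟩ := hfin.exists_eq_pow_mul_and_not_dvd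
  set m := multiplicity f F with hm
  have hmpos : 0 < m := by
    rw [hm]; exact Nat.pos_of_ne_zero (fun h0 => (multiplicity_ne_zero.mpr hfF) h0)
  have hhm : h.Monic := (hfm.pow m).of_mul_monic_left (hFh ▸ hFm)
  have hdeg : ∑ i, α i = m * f.natDegree + h.natDegree := by
    rw [← hFd, hFh, (hfm.pow m).natDegree_mul hhm, hfm.natDegree_pow]
  have hfpos := hfirr.natDegree_pos
  obtain ⟨u, hu⟩ := exists_prod_roots_aeval_eq (K := K) f hfm hfirr c
  obtain ⟨a, b, hab⟩ := (hfirr.coprime_iff_not_dvd.mpr hfh : IsCoprime f h)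
  -- `p` is congruent to `u` modulo `f` and to `1` modulo `h`
  let p : k[X] := u * (b * h) + a * f
  have hpf : ∀ μ : K, aeval μ f = 0 → aeval μ p = aeval μ u := by
    intro μ hμ
    have := congrArg (aeval μ) hab
    simp only [map_add, map_mul, hμ, mul_zero, zero_add, map_one] at this
    simp [p, hμ, this]
  have hph : ∀ μ : K, aeval μ h = 0 → aeval μ p = 1 := by
    intro μ hμ
    have := congrArg (aeval μ) hab
    simp only [map_add, map_mul, hμ, mul_zero, add_zero, map_one] at this
    simp [p, hμ, this]
  have hdet : piDet (aeval x p) = c ^ m := by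
    apply (algebraMap k K).injective
    have hne : (f.map (algebraMap k K)) ^ m * h.map (algebraMap k K) ≠ 0 :=
      (((hfm.map _).pow m).mul (hhm.map _)).ne_zero
    rw [algebraMap_piDet_aeval, ← hF, hFh, Polynomial.map_mul, Polynomial.map_pow, roots_mul hne,
      roots_pow, Multiset.map_add, Multiset.prod_add, Multiset.map_nsmul, Multiset.prod_nsmul,
      map_pow, hu]
    have h1 : ((h.map (algebraMap k K)).roots.map fun μ => aeval μ p).prod = 1 := by
      apply Multiset.prod_eq_one
      intro y hy
      obtain ⟨μ, hμ, rfl⟩ := Multiset.mem_map.mp hy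
      refine hph μ ?_
      simpa [eval_map_algebraMap] using (mem_roots'.mp hμ).2
    rw [h1, mul_one]
    congr 2
    refine Multiset.map_congr rfl fun μ hμ => hpf μ ?_
    simpa [eval_map_algebraMap] using (mem_roots'.mp hμ).2
  have hmem : aeval x p ∈ B := by
    have := (aeval (⟨x, hx⟩ : B) p).2
    rwa [← B.val_apply, ← aeval_algHom_apply] at this
  have h1 := hB _ hmem (by rw [hdet]; exact pow_ne_zero _ hc0)
  rw [hdet, hψ] at h1
  have hmn : ∑ i, α i ≤ m := by
    by_contra! hlt
    exact hc m hmpos hlt h1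
  have hmle : m ≤ m * f.natDegree := Nat.le_mul_of_pos_right m hfpos
  have hh1 : h = 1 := hhm.natDegree_eq_zero.mp (by omega)
  have hd1 : f.natDegree = 1 := by
    have : m * f.natDegree = m * 1 := by omega
    exact Nat.eq_of_mul_eq_mul_left hmpos this
  refine ⟨-f.coeff 0, m, ?_⟩
  have hfX : f = X + C (f.coeff 0) := hfm.eq_X_add_C hd1
  have hz := aeval_self_piCharpoly x
  rw [← hF, hFh, hh1, mul_one, map_pow] at hz
  rw [← hz]
  congr 1
  conv_rhs => rw [hfX]
  simp

theorem pow_mul_pow_eq_one_of_mul_eq_one {A : Type*} [Monoid A] {w x : A} (h : w * x = 1) (l : ℕ) :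
    w ^ l * x ^ l = 1 := by
  induction l with
  | zero => simp
  | succ l ih => rw [pow_succ, pow_succ', mul_assoc, ← mul_assoc w, h, one_mul, ih]

theorem IsNilpotent.subsingleton_of_mul_eq_one {A : Type*} [MonoidWithZero A] {w x : A}
    (hx : IsNilpotent x) (h : w * x = 1) : (1 : A) = 0 := by
  obtain ⟨l, hl⟩ := hx
  rw [← pow_mul_pow_eq_one_of_mul_eq_one h l, hl, mul_zero]

section
variable {I : Type} [Fintype I] {α : I → ℕ} {k : Type} [Field k]

/-- The sum of the traces of the components. -/
def piTrace (x : QMat I α k) : k := ∑ i, (x i).trace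

theorem piTrace_eq_zero_of_isNilpotent {x : QMat I α k} (hx : IsNilpotent x) : piTrace x = 0 := by
  refine Finset.sum_eq_zero fun i _ => ?_
  exact (isNilpotent_trace_of_isNilpotent
    (hx.map (Pi.evalRingHom (fun i => Matrix (Fin (α i)) (Fin (α i)) k) i))).eq_zero

theorem piTrace_algebraMap (a : k) :
    piTrace (algebraMap k (QMat I α k) a) = a * ((∑ i, α i : ℕ) : k) := by
  simp [piTrace, Pi.algebraMap_apply, Matrix.algebraMap_eq_diagonal, Finset.mul_sum, mul_comm]

theorem piTrace_add (x y : QMat I α k) : piTrace (x + y) = piTrace x + piTrace y := by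
  simp [piTrace, Finset.sum_add_distrib]

theorem QMat.one_ne_zero (hn : ∑ i, α i ≠ 0) : (1 : QMat I α k) ≠ 0 := by
  obtain ⟨i, -, hi⟩ := Finset.exists_ne_zero_of_sum_ne_zero hn
  intro h
  have : Nonempty (Fin (α i)) := ⟨⟨0, Nat.pos_of_ne_zero hi⟩⟩
  exact _root_.one_ne_zero (congrFun h i : (1 : Matrix (Fin (α i)) (Fin (α i)) k) = 0)

theorem isNilpotent_mul_of_scalar_add_nilpotent (hn : ∑ i, α i ≠ 0)
    (B : Subalgebra k (QMat I α k))
    (hB : ∀ x ∈ B, ∃ a : k, IsNilpotent (x - algebraMap k (QMat I α k) a))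
    {x y : QMat I α k} (hx : x ∈ B) (hy : y ∈ B) (hnx : IsNilpotent x) : IsNilpotent (y * x) := by
  obtain ⟨a, ha⟩ := hB _ (B.mul_mem hy hx)
  rcases eq_or_ne a 0 with rfl | ha0
  · simpa using ha
  · exfalso
    have hu : IsUnit (y * x) := by
      have h1 : IsUnit (algebraMap k (QMat I α k) a) := (IsUnit.mk0 a ha0).map _
      have := ha.isUnit_add_left_of_commute h1 ((Algebra.commutes a _).symm)
      simpa using this
    obtain ⟨z, hz⟩ := hu.exists_left_inv
    rw [← mul_assoc] at hz
    exact QMat.one_ne_zero hn (hnx.subsingleton_of_mul_eq_one hz)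

theorem isNilpotent_add_of_scalar_add_nilpotent (hn : ((∑ i, α i : ℕ) : k) ≠ 0)
    (B : Subalgebra k (QMat I α k))
    (hB : ∀ x ∈ B, ∃ a : k, IsNilpotent (x - algebraMap k (QMat I α k) a))
    {x y : QMat I α k} (hx : x ∈ B) (hy : y ∈ B) (hnx : IsNilpotent x) (hny : IsNilpotent y) :
    IsNilpotent (x + y) := by
  obtain ⟨a, ha⟩ := hB _ (B.add_mem hx hy)
  have h1 : piTrace (x + y) =
      piTrace (x + y - algebraMap k (QMat I α k) a) + piTrace (algebraMap k (QMat I α k) a) := by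
    rw [← piTrace_add, sub_add_cancel]
  rw [piTrace_add, piTrace_eq_zero_of_isNilpotent hnx, piTrace_eq_zero_of_isNilpotent hny,
    piTrace_eq_zero_of_isNilpotent ha, piTrace_algebraMap, zero_add, zero_add, eq_comm,
    mul_eq_zero, or_iff_left hn] at h1
  subst h1
  simpa using ha

/-- The nilpotent elements of a matrix algebra all of whose elements are scalar plus nilpotent form
a nilpotent subspace. -/
theorem exists_nilpotent_submodule (hn : ((∑ i, α i : ℕ) : k) ≠ 0)
    (B : Subalgebra k (QMat I α k))
    (hB : ∀ x ∈ B, ∃ a : k, IsNilpotent (x - algebraMap k (QMat I α k) a)) :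
    ∃ (N : Submodule k (QMat I α k)) (l : ℕ),
      (∀ x, x ∈ N ↔ x ∈ B ∧ IsNilpotent x) ∧ N ^ l = ⊥ := by
  have hn' : ∑ i, α i ≠ 0 := fun h => hn (by rw [h, Nat.cast_zero])
  have hval : ∀ z : B, IsNilpotent z ↔ IsNilpotent (z : QMat I α k) := fun z =>
    (IsNilpotent.map_iff (f := B.val) Subtype.val_injective).symm
  let J : Ideal B :=
    { carrier := {z | IsNilpotent z}
      zero_mem' := IsNilpotent.zero
      add_mem' := fun {a b} ha hb => by
        rw [Set.mem_ofPred_eq, hval] at *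
        exact isNilpotent_add_of_scalar_add_nilpotent hn B hB a.2 b.2 ha hb
      smul_mem' := fun c {a} ha => by
        rw [Set.mem_ofPred_eq, hval] at *
        exact isNilpotent_mul_of_scalar_add_nilpotent hn' B hB a.2 c.2 ha }
  have hJ : J ≤ Ideal.jacobson ⊥ := by
    intro z hz
    rw [Ideal.mem_jacobson_iff]
    intro y
    have h1 : IsNilpotent (y * z) := J.smul_mem y hz
    obtain ⟨w, hw⟩ := h1.isUnit_add_one.exists_left_inv
    refine ⟨w, ?_⟩
    rw [Ideal.mem_bot, ← hw]
    noncomm_ring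
  have : IsArtinianRing B := IsArtinianRing.of_finite k B
  obtain ⟨l, hl⟩ := IsArtinianRing.isNilpotent_jacobson_bot (R := B)
  let N : Submodule k (QMat I α k) := (J.restrictScalars k).map B.val.toLinearMap
  have hN : ∀ x, x ∈ N ↔ x ∈ B ∧ IsNilpotent x := by
    intro x
    constructor
    · rintro ⟨z, hz, rfl⟩
      exact ⟨z.2, (hval z).1 hz⟩
    · rintro ⟨hx, hx'⟩
      exact ⟨⟨x, hx⟩, (hval _).2 hx', rfl⟩
  refine ⟨N, l, hN, ?_⟩
  have key : ∀ j, ∀ x ∈ N ^ j, ∃ z ∈ (Ideal.jacobson (⊥ : Ideal B)) ^ j, (z : QMat I α k) = x := by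
    intro j
    induction j with
    | zero =>
      intro x hx
      rw [pow_zero, Submodule.mem_one] at hx
      obtain ⟨a, rfl⟩ := hx
      refine ⟨algebraMap k B a, ?_, Subalgebra.coe_algebraMap B a⟩
      rw [Submodule.pow_zero, Submodule.one_eq_span, Submodule.mem_span_singleton]
      exact ⟨algebraMap k B a, by rw [smul_eq_mul, mul_one]⟩
    | succ j ih =>
      intro x hx
      rw [Submodule.pow_succ] at hx
      induction hx using Submodule.mul_induction_on' with
      | mem_mul_mem m hm x hx =>
        obtain ⟨z, hz, rfl⟩ := ih m hm
        obtain ⟨hxB, hxn⟩ := (hN x).1 hx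
        refine ⟨z * ⟨x, hxB⟩, ?_, rfl⟩
        rw [Submodule.pow_succ]
        exact Submodule.mul_mem_mul hz (hJ ((hval _).2 hxn))
      | add x _ y _ hx hy =>
        obtain ⟨z, hz, rfl⟩ := hx
        obtain ⟨w, hw, rfl⟩ := hy
        exact ⟨z + w, Ideal.add_mem _ hz hw, rfl⟩
  rw [eq_bot_iff]
  intro x hx
  obtain ⟨z, hz, rfl⟩ := key l x hx
  rw [hl] at hz
  simp only [Submodule.mem_bot]
  rw [(Submodule.mem_bot (R := B)).1 hz]
  rfl

/-- Entrywise base change of tuples of matrices. -/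
abbrev QMat.map {I : Type} {α : I → ℕ} {S T : Type} [CommRing S] [CommRing T] (f : S →+* T) :
    QMat I α S →+* QMat I α T :=
  RingHom.pi fun i => f.mapMatrix.comp (Pi.evalRingHom _ i)

theorem eq_zero_or_one_of_isIdempotent_of_mem_span {K : Type} [Field K] [Algebra k K]
    (hn : ((∑ i, α i : ℕ) : k) ≠ 0) (B : Subalgebra k (QMat I α k))
    (hB : ∀ x ∈ B, ∃ a : k, IsNilpotent (x - algebraMap k (QMat I α k) a))
    (e : QMat I α K) (he : IsIdempotentElem e)
    (hspan : e ∈ Submodule.span K (QMat.map (algebraMap k K) '' (B : Set (QMat I α k)))) :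
    e = 0 ∨ e = 1 := by
  obtain ⟨N, l, hN, hNl⟩ := exists_nilpotent_submodule hn B hB
  set φ := QMat.map (I := I) (α := α) (algebraMap k K) with hφ
  let W : Submodule K (QMat I α K) := Submodule.span K (φ '' (N : Set (QMat I α k)))
  have hWl : W ^ l = ⊥ := by
    rw [Submodule.span_pow, Submodule.span_eq_bot, ← Set.image_pow]
    rintro _ ⟨x, hx, rfl⟩
    have := Submodule.pow_subset_pow N hx
    rw [hNl] at this
    rw [show x = 0 from this, map_zero]
  have hWn : ∀ w ∈ W, IsNilpotent w := by
    intro w hw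
    have := Submodule.pow_mem_pow W hw l
    rw [hWl] at this
    exact ⟨l, this⟩
  have hφa : ∀ a : k, φ (algebraMap k _ a) = algebraMap K (QMat I α K) (algebraMap k K a) := by
    intro a
    funext i
    change (algebraMap k (Matrix (Fin (α i)) (Fin (α i)) k) a).map (algebraMap k K) =
      algebraMap K (Matrix (Fin (α i)) (Fin (α i)) K) (algebraMap k K a)
    rw [Matrix.algebraMap_eq_diagonal, Matrix.algebraMap_eq_diagonal,
      Matrix.diagonal_map (map_zero _)]
    rfl
  have hdec : ∃ c : K, ∃ w ∈ W, e = algebraMap K _ c + w := by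
    clear he
    induction hspan using Submodule.span_induction with
    | mem x hx =>
      obtain ⟨y, hy, rfl⟩ := hx
      obtain ⟨a, ha⟩ := hB y hy
      refine ⟨algebraMap k K a, φ (y - algebraMap k _ a), Submodule.subset_span ⟨_, ?_, rfl⟩, ?_⟩
      · exact (hN _).2 ⟨B.sub_mem hy (B.algebraMap_mem a), ha⟩
      · rw [map_sub, hφa, add_sub_cancel]
    | zero => exact ⟨0, 0, W.zero_mem, by simp⟩
    | add x y _ _ hx hy =>
      obtain ⟨c, w, hw, rfl⟩ := hx
      obtain ⟨c', w', hw', rfl⟩ := hy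
      exact ⟨c + c', w + w', W.add_mem hw hw', by rw [map_add]; abel⟩
    | smul a x _ hx =>
      obtain ⟨c, w, hw, rfl⟩ := hx
      exact ⟨a * c, a • w, W.smul_mem a hw, by rw [map_mul, smul_add, Algebra.smul_def]⟩
  obtain ⟨c, w, hw, rfl⟩ := hdec
  have hwn := hWn w hw
  rcases eq_or_ne c 0 with rfl | hc
  · left
    rw [map_zero, zero_add] at he ⊢
    obtain ⟨j, hj⟩ := hwn
    rcases Nat.eq_zero_or_pos j with rfl | hj0
    · rw [pow_zero] at hj
      rw [← mul_one w, hj, mul_zero]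
    · rw [← he.pow_eq hj0.ne', hj]
  · right
    have h1 : IsUnit (algebraMap K (QMat I α K) c) := (IsUnit.mk0 c hc).map _
    have hu := hwn.isUnit_add_left_of_commute h1 ((Algebra.commutes c _).symm)
    exact hu.mul_left_cancel (by rw [mul_one]; exact he)

end

open scoped TensorProduct

/-- Over a local ring every idempotent matrix is conjugate to a standard one. -/
theorem exists_conj_eq_diagonal {T : Type} [CommRing T] [IsLocalRing T] {n : ℕ}
    (e : Matrix (Fin n) (Fin n) T) (he : IsIdempotentElem e) :
    ∃ b ≤ n, ∃ h : (Matrix (Fin n) (Fin n) T)ˣ,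
      h.val * e * h.inv = Matrix.diagonal fun r : Fin n => if (r : ℕ) < b then 1 else 0 := by
  let f := Matrix.toLin' e
  have hf : IsIdempotentElem f := he.map Matrix.toLinAlgEquiv'
  have hcompl := LinearMap.IsIdempotentElem.isCompl hf
  have hpW : Module.Projective T (LinearMap.range f) :=
    Module.Projective.of_split (LinearMap.range f).subtype f.rangeRestrict (by
      ext ⟨_, y, rfl⟩ : 1
      exact Subtype.ext (LinearMap.congr_fun hf y))
  have hpV : Module.Projective T (LinearMap.ker f) :=
    Module.Projective.of_split (LinearMap.ker f).subtype
      ((LinearMap.id - f).codRestrict (LinearMap.ker f) (fun y => by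
        have := LinearMap.congr_fun hf y
        simp only [Module.End.mul_apply] at this
        simp [this])) (by
      ext ⟨y, hy⟩ : 1
      refine Subtype.ext ?_
      simp only [LinearMap.mem_ker] at hy
      simp [hy])
  have hfW : Module.Finite T (LinearMap.range f) := inferInstance
  have hfV : Module.Finite T (LinearMap.ker f) :=
    Module.Finite.of_surjective ((LinearMap.id - f).codRestrict (LinearMap.ker f) (fun y => by
        have := LinearMap.congr_fun hf y
        simp only [Module.End.mul_apply] at this
        simp [this])) (by
      rintro ⟨y, hy⟩
      refine ⟨y, Subtype.ext ?_⟩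
      simp only [LinearMap.mem_ker] at hy
      simp [hy])
  have hW : Module.Free T (LinearMap.range f) := Module.free_of_flat_of_isLocalRing
  have hV : Module.Free T (LinearMap.ker f) := Module.free_of_flat_of_isLocalRing
  let b := Module.finrank T (LinearMap.range f)
  let c := Module.finrank T (LinearMap.ker f)
  let B₀ : Module.Basis (Fin b ⊕ Fin c) T (Fin n → T) :=
    ((Module.finBasis T (LinearMap.range f)).prod (Module.finBasis T (LinearMap.ker f))).map
      (Submodule.prodEquivOfIsCompl _ _ hcompl)
  have hbc : b + c = n := by
    have h1 := Module.finrank_eq_card_basis B₀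
    simp at h1
    exact h1.symm
  let σ : Fin b ⊕ Fin c ≃ Fin n := finSumFinEquiv.trans (finCongr hbc)
  let B : Module.Basis (Fin n) T (Fin n → T) := B₀.reindex σ
  have hfB : ∀ j : Fin n, f (B j) = if (j : ℕ) < b then B j else 0 := by
    intro j
    obtain ⟨j, rfl⟩ := σ.surjective j
    rcases j with j | j
    · have h1 : ((σ (Sum.inl j) : Fin n) : ℕ) < b := by simp [σ]
      rw [if_pos h1]
      have h2 : B (σ (Sum.inl j)) = (Module.finBasis T (LinearMap.range f) j : Fin n → T) := by
        simp [B, B₀]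
      rw [h2]
      obtain ⟨y, hy⟩ := (Module.finBasis T (LinearMap.range f) j).2
      rw [← hy]
      exact LinearMap.congr_fun hf y
    · have h1 : ¬ ((σ (Sum.inr j) : Fin n) : ℕ) < b := by simp [σ]
      rw [if_neg h1]
      have h2 : B (σ (Sum.inr j)) = (Module.finBasis T (LinearMap.ker f) j : Fin n → T) := by
        simp [B, B₀]
      rw [h2]
      exact (Module.finBasis T (LinearMap.ker f) j).2
  clear_value B
  refine ⟨b, by omega, ⟨B.toMatrix (Pi.basisFun T (Fin n)), (Pi.basisFun T (Fin n)).toMatrix B,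
    B.toMatrix_mul_toMatrix_flip _, Module.Basis.toMatrix_mul_toMatrix_flip _ _⟩, ?_⟩
  have h1 := basis_toMatrix_mul_linearMap_toMatrix_mul_basis_toMatrix
    (b := B) (b' := Pi.basisFun T (Fin n)) (c := B) (c' := Pi.basisFun T (Fin n)) f
  rw [LinearMap.toMatrix_eq_toMatrix', LinearMap.toMatrix'_toLin'] at h1
  refine h1.trans ?_
  ext r j
  rw [LinearMap.toMatrix_apply, hfB, Matrix.diagonal_apply]
  by_cases h2 : (j : ℕ) < b
  · rw [if_pos h2, Module.Basis.repr_self, Finsupp.single_apply]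
    by_cases h3 : r = j
    · subst h3
      rw [if_pos rfl, if_pos rfl, if_pos h2]
    · rw [if_neg h3, if_neg (Ne.symm h3)]
  · rw [if_neg h2, map_zero, Finsupp.zero_apply]
    by_cases h3 : r = j
    · subst h3
      rw [if_pos rfl, if_neg h2]
    · rw [if_neg h3]

section
variable {k : Type} [Field k] {S : Type} [CommRing S] [Algebra k S] (ρ : S →ₐ[k] k)
  (hρ : ∀ x, ρ x = 0 → IsNilpotent x)

include hρ in
theorem isUnit_of_augmentation_ne_zero {x : S} (hx : ρ x ≠ 0) : IsUnit x := by
  have h1 : IsNilpotent (x - algebraMap k S (ρ x)) := hρ _ (by simp)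
  have h2 := h1.isUnit_add_left_of_commute ((IsUnit.mk0 _ hx).map (algebraMap k S))
    (Commute.all _ _)
  simpa using h2

/-- The augmentation `S ⊗ K → K` induced by an augmentation `S → k`. -/
noncomputable def tensorAug (K : Type) [Field K] [Algebra k K] : S ⊗[k] K →ₐ[k] K :=
  Algebra.TensorProduct.productMap ((Algebra.ofId k K).comp ρ) (AlgHom.id k K)

theorem tensorAug_tmul (K : Type) [Field K] [Algebra k K] (x : S) (c : K) :
    tensorAug ρ K (x ⊗ₜ c) = algebraMap k K (ρ x) * c := by
  simp [tensorAug, Algebra.ofId_apply]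

include hρ in
theorem isNilpotent_sub_tensorAug (K : Type) [Field K] [Algebra k K] (z : S ⊗[k] K) :
    IsNilpotent (z - (1 : S) ⊗ₜ[k] tensorAug ρ K z) := by
  induction z using TensorProduct.induction_on with
  | zero => simp
  | tmul x c =>
    have h1 : IsNilpotent (x - algebraMap k S (ρ x)) := hρ _ (by simp)
    have h2 := h1.map (Algebra.TensorProduct.includeLeft : S →ₐ[k] S ⊗[k] K)
    have h3 := (Commute.all ((Algebra.TensorProduct.includeLeft : S →ₐ[k] S ⊗[k] K)
      (x - algebraMap k S (ρ x))) (1 ⊗ₜ[k] c)).isNilpotent_mul_right h2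
    refine (congrArg IsNilpotent ?_).mpr h3
    rw [tensorAug_tmul]
    rw [Algebra.TensorProduct.includeLeft_apply, Algebra.TensorProduct.tmul_mul_tmul, mul_one,
      one_mul, TensorProduct.sub_tmul, Algebra.algebraMap_eq_smul_one (A := S), TensorProduct.smul_tmul,
      Algebra.smul_def]
  | add x y hx hy =>
    rw [map_add, TensorProduct.tmul_add, add_sub_add_comm]
    exact (Commute.all _ _).isNilpotent_add hx hy

include hρ in
theorem isNilpotent_of_tensorAug_eq_zero (K : Type) [Field K] [Algebra k K] (z : S ⊗[k] K)
    (hz : tensorAug ρ K z = 0) : IsNilpotent z := by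
  simpa [hz] using isNilpotent_sub_tensorAug ρ hρ K z

include hρ in
theorem isLocalRing_tensor (K : Type) [Field K] [Algebra k K] : IsLocalRing (S ⊗[k] K) := by
  have : IsLocalHom (tensorAug ρ K).toRingHom := by
    refine ⟨fun z hz => ?_⟩
    have h1 := isNilpotent_sub_tensorAug ρ hρ K z
    have h2 : IsUnit ((1 : S) ⊗ₜ[k] tensorAug ρ K z) :=
      hz.map (Algebra.TensorProduct.includeRight : K →ₐ[k] S ⊗[k] K)
    have h3 := h1.isUnit_add_left_of_commute h2 (Commute.all _ _)
    simpa using h3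
  exact RingHom.domain_isLocalRing (tensorAug ρ K).toRingHom

end

section
open Polynomial
variable {I : Type} [Fintype I] {α : I → ℕ}

theorem eval_eq_zero_of_aeval_eq_zero {K : Type} [Field K] [IsAlgClosed K]
    (x : QMat I α K) (p : K[X]) (hp : aeval x p = 0) (μ : K) (hμ : (piCharpoly x).IsRoot μ) :
    p.eval μ = 0 := by
  have h1 := algebraMap_piDet_aeval (K := K) x (p - C (p.eval μ))
  have h2 : (((piCharpoly x).map (algebraMap K K)).roots.map
      fun ν => aeval ν (p - C (p.eval μ))).prod = 0 := by
    rw [Multiset.prod_eq_zero_iff, Multiset.mem_map]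
    refine ⟨μ, ?_, by simp⟩
    rw [Algebra.algebraMap_self, Polynomial.map_id]
    exact (mem_roots (piCharpoly_monic x).ne_zero).2 hμ
  rw [h2, Algebra.algebraMap_self, RingHom.id_apply, map_sub, hp, aeval_C, zero_sub, ← map_neg,
    piDet, Finset.prod_eq_zero_iff] at h1
  obtain ⟨i, -, hi⟩ := h1
  rw [Pi.algebraMap_apply, Algebra.algebraMap_eq_smul_one, det_smul, det_one, mul_one] at hi
  exact neg_eq_zero.mp (eq_zero_of_pow_eq_zero hi)

omit [Fintype I] in
theorem QMat.aeval_map {S T : Type} [CommRing S] [CommRing T] (f : S →+* T) (x : QMat I α S)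
    (p : S[X]) : QMat.map f (aeval x p) = aeval (QMat.map f x) (p.map f) := by
  refine map_aeval_eq_aeval_map ?_ p x
  ext a i : 2
  change _ = (algebraMap S (Matrix (Fin (α i)) (Fin (α i)) S) a).map f
  rw [Matrix.algebraMap_eq_diagonal, Matrix.diagonal_map (map_zero f)]
  change algebraMap T (Matrix (Fin (α i)) (Fin (α i)) T) (f a) = _
  rw [Matrix.algebraMap_eq_diagonal]
  rfl

theorem piCharpoly_map {S T : Type} [CommRing S] [CommRing T] (f : S →+* T) (x : QMat I α S) :
    piCharpoly (QMat.map f x) = (piCharpoly x).map f := by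
  rw [piCharpoly, piCharpoly, Polynomial.map_prod]
  exact Finset.prod_congr rfl fun i _ => Matrix.charpoly_map (x i) f

theorem piDet_map {S T : Type} [CommRing S] [CommRing T] (f : S →+* T) (x : QMat I α S) :
    piDet (QMat.map f x) = f (piDet x) := by
  rw [piDet, piDet, map_prod]
  exact Finset.prod_congr rfl fun i _ => (RingHom.map_det f (x i)).symm

theorem QMat.isNilpotent_of_map_eq_zero {S T : Type} [CommRing S] [CommRing T] (f : S →+* T)
    (hf : ∀ z, f z = 0 → IsNilpotent z) (x : QMat I α S) (hx : QMat.map f x = 0) :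
    IsNilpotent x := by
  have h1 : (piCharpoly x).map f = X ^ ∑ i, α i := by
    rw [← piCharpoly_map, hx, piCharpoly, ← Finset.prod_pow_eq_pow_sum]
    refine Finset.prod_congr rfl fun i _ => ?_
    simp
  have h2 : IsNilpotent (piCharpoly x - X ^ ∑ i, α i) := by
    rw [Polynomial.isNilpotent_iff]
    intro j
    refine hf _ ?_
    rw [← coeff_map, Polynomial.map_sub, h1, Polynomial.map_pow, map_X, sub_self, coeff_zero]
  have h3 := h2.map (aeval (R := S) x)
  rw [map_sub, aeval_self_piCharpoly, zero_sub, map_pow, aeval_X, isNilpotent_neg_iff] at h3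
  obtain ⟨j, hj⟩ := h3
  exact ⟨(∑ i, α i) * j, by rw [pow_mul, hj]⟩

/-- A tuple over `k` whose determinant is not an `n`-th power has two distinct eigenvalues. -/
theorem exists_two_roots {k : Type} [Field k] (K : Type) [Field K] [Algebra k K] [IsAlgClosed K]
    (hn : (∑ i, α i) = 0 ∨ ((∑ i, α i : ℕ) : k) ≠ 0) (x : QMat I α k)
    (hx : ¬ ∃ a : k, piDet x = a ^ ∑ i, α i) :
    ∃ μ ν : K, μ ≠ ν ∧ ((piCharpoly x).map (algebraMap k K)).IsRoot μ ∧
      ((piCharpoly x).map (algebraMap k K)).IsRoot ν := by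
  set F := (piCharpoly x).map (algebraMap k K) with hF
  have hFm : F.Monic := (piCharpoly_monic x).map _
  have hdeg : F.natDegree = ∑ i, α i := by
    rw [hF, (piCharpoly_monic x).natDegree_map, piCharpoly_natDegree]
  have hsp := IsAlgClosed.splits F
  have hcard : F.roots.card = ∑ i, α i := by rw [← hsp.natDegree_eq_card_roots, hdeg]
  have hdet : algebraMap k K (piDet x) = F.roots.prod := by
    simpa [hF] using algebraMap_piDet_aeval (K := K) x X
  rcases eq_or_ne (∑ i, α i) 0 with h0 | h0
  · refine absurd ⟨1, ?_⟩ hx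
    apply (algebraMap k K).injective
    rw [h0] at hcard
    rw [hdet, Multiset.card_eq_zero.mp hcard]
    simp
  have hnk := hn.resolve_left h0
  by_contra! hcon
  apply hx
  obtain ⟨μ, hμ⟩ := Multiset.card_pos_iff_exists_mem.mp (hcard ▸ Nat.pos_of_ne_zero h0)
  have hroots : F.roots = Multiset.replicate (∑ i, α i) μ := by
    rw [Multiset.eq_replicate]
    refine ⟨hcard, fun ν hν => ?_⟩
    by_contra hne
    exact hcon ν μ hne (mem_roots'.mp hν).2 (mem_roots'.mp hμ).2
  have hnext : F.nextCoeff = -((∑ i, α i : ℕ) : K) * μ := by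
    rw [hsp.nextCoeff_eq_neg_sum_roots_of_monic hFm, hroots, Multiset.sum_replicate,
      nsmul_eq_mul, neg_mul]
  have hnK : ((∑ i, α i : ℕ) : K) ≠ 0 := by
    rw [← map_natCast (algebraMap k K)]
    exact (_root_.map_ne_zero _).mpr hnk
  refine ⟨-(piCharpoly x).nextCoeff / ((∑ i, α i : ℕ) : k), (algebraMap k K).injective ?_⟩
  rw [hdet, hroots, Multiset.prod_replicate, map_pow]
  congr 1
  rw [map_div₀, map_neg, map_natCast, ← nextCoeff_map (algebraMap k K).injective, ← hF, hnext]
  field_simp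

/-- A polynomial separating two distinct roots of `F`, idempotent modulo a power of `F`. -/
theorem exists_separating_poly {K : Type} [Field K] (F : K[X]) (hF : F.Monic) (L : ℕ) {μ ν : K}
    (hμν : μ ≠ ν) (hμ : F.IsRoot μ) (hν : F.IsRoot ν) :
    ∃ p : K[X], F ^ L ∣ p * (1 - p) ∧ (L ≠ 0 → p.eval μ = 1 ∧ p.eval ν = 0) := by
  obtain ⟨h, hFh, hnd⟩ := exists_eq_pow_rootMultiplicity_mul_and_not_dvd F hF.ne_zero μ
  have hm : F.rootMultiplicity μ ≠ 0 := (rootMultiplicity_pos hF.ne_zero).mpr hμ |>.ne'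
  have hcop : IsCoprime ((X - C μ) ^ F.rootMultiplicity μ) h :=
    IsCoprime.pow_left ((irreducible_X_sub_C μ).coprime_iff_not_dvd.mpr hnd)
  set m := F.rootMultiplicity μ
  obtain ⟨u, v, huv⟩ := (hcop.pow (m := L) (n := L))
  have hhν : h.eval ν = 0 := by
    rw [IsRoot, hFh, eval_mul, mul_eq_zero] at hν
    refine hν.resolve_left ?_
    simp [sub_eq_zero, hμν.symm]
  refine ⟨v * h ^ L, ?_, fun hL => ⟨?_, by simp [hhν, hL]⟩⟩
  · have h1 : 1 - v * h ^ L = u * ((X - C μ) ^ m) ^ L := by rw [← huv]; ring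
    rw [h1]
    refine ⟨u * v, ?_⟩
    conv_rhs => rw [hFh]
    ring
  · have := congrArg (eval μ) huv
    simpa [hm, hL] using this

end

section
variable {I E : Type} (s t : E → I) (α : I → ℕ)

/-- The endomorphism algebra of a representation. -/
def endAlg (k : Type) [CommRing k] {S : Type} [CommRing S] [Algebra k S] (M : QRep I E s t α S) :
    Subalgebra k (QMat I α S) where
  carrier := {x | ∀ a, x (t a) * M a = M a * x (s a)}
  mul_mem' {x y} hx hy a := by
    change x (t a) * y (t a) * M a = M a * (x (s a) * y (s a))
    rw [Matrix.mul_assoc, hy a, ← Matrix.mul_assoc, hx a, Matrix.mul_assoc]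
  add_mem' {x y} hx hy a := by
    change (x (t a) + y (t a)) * M a = M a * (x (s a) + y (s a))
    rw [Matrix.add_mul, Matrix.mul_add, hx a, hy a]
  algebraMap_mem' c a := by
    simp only [Pi.algebraMap_apply, Algebra.algebraMap_eq_smul_one]
    rw [Matrix.smul_mul, Matrix.mul_smul, Matrix.one_mul, Matrix.mul_one]

variable {s t α}

theorem mem_endAlg {k : Type} [CommRing k] {S : Type} [CommRing S] [Algebra k S]
    {M : QRep I E s t α S} {x : QMat I α S} :
    x ∈ endAlg s t α k M ↔ ∀ a, x (t a) * M a = M a * x (s a) := Iff.rfl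

theorem QAct_eq_iff {S : Type} [CommRing S] (g : QGl I α S) (M N : QRep I E s t α S) :
    QAct s t α g M = N ↔ ∀ a, (g (t a)).val * M a = N a * (g (s a)).val := by
  rw [funext_iff]
  refine forall_congr' fun a => ?_
  constructor
  · intro h
    rw [← h, QAct, Matrix.mul_assoc _ (g (s a)).inv, Units.inv_val, Matrix.mul_one]
  · intro h
    rw [QAct, h, Matrix.mul_assoc, Units.val_inv, Matrix.mul_one]

theorem QAct_eq_self_iff {S : Type} [CommRing S] (g : QGl I α S) (M : QRep I E s t α S) :
    QAct s t α g M = M ↔ (fun i => (g i).val) ∈ endAlg s t α S M :=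
  QAct_eq_iff g M M

theorem diagonal_mul_apply_eq {S : Type} [CommRing S] {m n : ℕ} (p q : ℕ)
    {A : Matrix (Fin m) (Fin n) S} :
    (Matrix.diagonal (fun r : Fin m => if (r : ℕ) < p then (1 : S) else 0) * A =
      A * Matrix.diagonal fun r : Fin n => if (r : ℕ) < q then (1 : S) else 0) ↔
    ∀ (r : Fin m) (c : Fin n), (((r : ℕ) < p ∧ q ≤ (c : ℕ)) ∨ (p ≤ (r : ℕ) ∧ (c : ℕ) < q)) → A r c = 0 := by
  rw [← Matrix.ext_iff]
  refine forall_congr' fun r => forall_congr' fun c => ?_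
  rw [diagonal_mul, mul_diagonal]
  by_cases h1 : (r : ℕ) < p <;> by_cases h2 : (c : ℕ) < q <;>
    simp [h1, h2, not_le.mpr, not_lt.mp, eq_comm]

theorem QDecomposable_iff_exists_idempotent {T : Type} [CommRing T] [IsLocalRing T]
    (M : QRep I E s t α T) :
    QDecomposable s t α T M ↔ ∃ e ∈ endAlg s t α T M, IsIdempotentElem e ∧ e ≠ 0 ∧ e ≠ 1 := by
  have key : ∀ (g : QGl I α T) (β : I → ℕ),
      (∀ (a : E) (r : Fin (α (t a))) (c : Fin (α (s a))),
      (((r : ℕ) < β (t a) ∧ β (s a) ≤ (c : ℕ)) ∨ (β (t a) ≤ (r : ℕ) ∧ (c : ℕ) < β (s a))) →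
      QAct s t α g M a r c = 0) ↔ (fun i => (g i).inv * Matrix.diagonal
        (fun r : Fin (α i) => if (r : ℕ) < β i then (1 : T) else 0) * (g i).val) ∈
          endAlg s t α T M := by
    intro g β
    rw [mem_endAlg]
    refine forall_congr' fun a => ?_
    rw [← diagonal_mul_apply_eq, QAct]
    set D := Matrix.diagonal (fun r : Fin (α (t a)) => if (r : ℕ) < β (t a) then (1 : T) else 0)
    set D' := Matrix.diagonal (fun r : Fin (α (s a)) => if (r : ℕ) < β (s a) then (1 : T) else 0)
    constructor
    · intro h
      have := congrArg (fun z => (g (t a)).inv * z * (g (s a)).val) h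
      calc _ = (g (t a)).inv * (D * ((g (t a)).val * M a * (g (s a)).inv)) * (g (s a)).val := by
            simp only [Matrix.mul_assoc]; rw [Units.inv_val, Matrix.mul_one]
        _ = _ := by rw [h]; simp only [← Matrix.mul_assoc]; rw [Units.inv_val, Matrix.one_mul]
    · intro h
      calc _ = (g (t a)).val * ((g (t a)).inv * D * (g (t a)).val * M a) * (g (s a)).inv := by
            simp only [← Matrix.mul_assoc]; rw [Units.val_inv, Matrix.one_mul]
        _ = _ := by rw [h]; simp only [Matrix.mul_assoc]; rw [Units.val_inv, Matrix.mul_one]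
  constructor
  · rintro ⟨β, γ, hβγ, hβ, hγ, g, hg⟩
    refine ⟨_, (key g β).mp hg, ?_, ?_, ?_⟩
    · funext i
      let D := Matrix.diagonal (fun r : Fin (α i) => if (r : ℕ) < β i then (1 : T) else 0)
      change (g i).inv * D * (g i).val * ((g i).inv * D * (g i).val) = (g i).inv * D * (g i).val
      have hD : D * D = D := by
        simp only [D, diagonal_mul_diagonal]
        congr 1; funext r; split_ifs <;> simp
      calc _ = (g i).inv * (D * ((g i).val * (g i).inv) * D) * (g i).val := by
            simp only [Matrix.mul_assoc]
        _ = _ := by rw [Units.val_inv, Matrix.mul_one, hD]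
    · intro h0
      apply hβ
      funext i
      by_contra hi
      have hi' : 0 < β i := Nat.pos_of_ne_zero hi
      have h1 : Matrix.diagonal (fun r : Fin (α i) => if (r : ℕ) < β i then (1 : T) else 0) = 0 := by
        have := congrArg (fun z => (g i).val * z * (g i).inv) (congrFun h0 i)
        simpa [← Matrix.mul_assoc, Units.val_inv, -Matrix.diagonal_eq_zero] using this
      have h2 := congrFun (congrFun h1 ⟨0, by have := hβγ i; omega⟩) ⟨0, by have := hβγ i; omega⟩
      simp [hi'] at h2
    · intro h0
      apply hγ
      funext i
      by_contra hi
      have hi' : 0 < γ i := Nat.pos_of_ne_zero hi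
      have h1 : Matrix.diagonal (fun r : Fin (α i) => if (r : ℕ) < β i then (1 : T) else 0) = 1 := by
        calc _ = (g i).val * ((g i).inv * Matrix.diagonal
                (fun r : Fin (α i) => if (r : ℕ) < β i then (1 : T) else 0) * (g i).val) *
                (g i).inv := by
              simp only [Matrix.mul_assoc]
              rw [Units.val_inv, Matrix.mul_one, ← Matrix.mul_assoc, Units.val_inv, Matrix.one_mul]
          _ = 1 := by
              rw [congrFun h0 i]
              simp
      have h2 := congrFun (congrFun h1 ⟨β i, by have := hβγ i; omega⟩)
        ⟨β i, by have := hβγ i; omega⟩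
      simp at h2
  · rintro ⟨e, heM, he, h0, h1⟩
    choose b hb g hg using fun i => exists_conj_eq_diagonal (e i) (congrFun he i)
    have hE : (fun i => (g i).inv * Matrix.diagonal
        (fun r : Fin (α i) => if (r : ℕ) < b i then (1 : T) else 0) * (g i).val) = e := by
      funext i
      rw [← hg i]
      simp only [← Matrix.mul_assoc]
      rw [Units.inv_val, Matrix.one_mul, Matrix.mul_assoc, Units.inv_val, Matrix.mul_one]
    refine ⟨b, fun i => α i - b i, fun i => Nat.add_sub_of_le (hb i), ?_, ?_, g,
      (key g b).mpr (hE ▸ heM)⟩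
    · rintro rfl
      apply h0
      rw [← hE]
      funext i
      simp
    · intro hγ
      apply h1
      rw [← hE]
      funext i
      have : (fun r : Fin (α i) => if (r : ℕ) < b i then (1 : T) else 0) = 1 := by
        funext r
        have h3 : α i - b i = 0 := congrFun hγ i
        have h4 := r.2
        rw [if_pos (by omega)]; rfl
      rw [this]
      change _ * Matrix.diagonal (fun _ => 1) * _ = 1
      rw [diagonal_one, Matrix.mul_one, Units.inv_val]

end

section
open Polynomial
variable {I E : Type} [Fintype I] {s t : E → I} {α : I → ℕ}

theorem not_QAbsInd_of_not_pow {k : Type} [Field k] {S : Type} [CommRing S] [Algebra k S]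
    (ρ : S →ₐ[k] k) (hρ : ∀ x, ρ x = 0 → IsNilpotent x)
    (hn : (∑ i, α i) = 0 ∨ ((∑ i, α i : ℕ) : k) ≠ 0) (M : QRep I E s t α S) (x : QMat I α S)
    (hx : x ∈ endAlg s t α k M)
    (hdet : ¬ ∃ a : k, piDet (QMat.map ρ.toRingHom x) = a ^ ∑ i, α i) :
    ¬ QAbsInd k s t α S M := by
  rw [QAbsInd, not_not]
  set K := AlgebraicClosure k
  have := isLocalRing_tensor ρ hρ K
  rw [QDecomposable_iff_exists_idempotent]
  set G : QMat I α (S ⊗[k] K) := QMat.map (algebraMap S (S ⊗[k] K)) x with hG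
  set MT : QRep I E s t α (S ⊗[k] K) := fun a => (M a).map (algebraMap S (S ⊗[k] K)) with hMT
  have hGM : G ∈ endAlg s t α (S ⊗[k] K) MT := by
    intro a
    have h := congrArg (fun z => z.map (algebraMap S (S ⊗[k] K))) (hx a)
    simp only [Matrix.map_mul] at h
    exact h
  let ι : K →+* S ⊗[k] K := (Algebra.TensorProduct.includeRight : K →ₐ[k] S ⊗[k] K).toRingHom
  let Φ : S ⊗[k] K →+* K := (tensorAug ρ K).toRingHom
  have hΦι : Φ.comp ι = RingHom.id K := by
    ext c
    exact (tensorAug_tmul ρ K 1 c).trans (by simp)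
  set xb : QMat I α k := QMat.map ρ.toRingHom x with hxb
  have hΦG : QMat.map Φ G = QMat.map (algebraMap k K) xb := by
    funext i
    ext r c
    exact (tensorAug_tmul ρ K (x i r c) 1).trans (by simp [hxb])
  obtain ⟨μ, ν, hμν, hμ, hν⟩ := exists_two_roots K hn xb hdet
  set F := (piCharpoly xb).map (algebraMap k K) with hF
  have hFm : F.Monic := (piCharpoly_monic xb).map _
  have hFG : F = piCharpoly (QMat.map Φ G) := by rw [hΦG, piCharpoly_map]
  have hΦ : ∀ p : K[X], QMat.map Φ (aeval G (p.map ι)) = aeval (QMat.map Φ G) p := by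
    intro p
    rw [QMat.aeval_map, Polynomial.map_map, hΦι, Polynomial.map_id]
  have hnil : IsNilpotent (aeval G (F.map ι)) := by
    refine QMat.isNilpotent_of_map_eq_zero Φ
      (fun z hz => isNilpotent_of_tensorAug_eq_zero ρ hρ K z hz) _ ?_
    rw [hΦ, hFG, aeval_self_piCharpoly]
  obtain ⟨L, hL⟩ := hnil
  obtain ⟨p, ⟨q, hq⟩, hp⟩ := exists_separating_poly F hFm (L + 1) hμν hμ hν
  obtain ⟨hp1, hp0⟩ := hp (Nat.succ_ne_zero L)
  refine ⟨aeval G (p.map ι), ?_, ?_, ?_, ?_⟩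
  · exact Algebra.adjoin_le (Set.singleton_subset_iff.mpr hGM) (aeval_mem_adjoin_singleton _ _)
  · have h1 : aeval G ((p * (1 - p)).map ι) = 0 := by
      rw [hq, Polynomial.map_mul, Polynomial.map_pow, map_mul, map_pow, pow_succ, hL, zero_mul,
        zero_mul]
    rw [Polynomial.map_mul, Polynomial.map_sub, Polynomial.map_one, map_mul, map_sub, map_one,
      mul_sub, mul_one, sub_eq_zero] at h1
    exact h1.symm
  · intro h0
    have h1 := hΦ p
    rw [h0, map_zero] at h1
    have := eval_eq_zero_of_aeval_eq_zero (QMat.map Φ G) p h1.symm μ (hFG ▸ hμ)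
    rw [hp1] at this
    exact one_ne_zero this
  · intro h0
    have h1 := hΦ (1 - p)
    rw [Polynomial.map_sub, Polynomial.map_one, map_sub, map_one, h0, sub_self, map_zero] at h1
    have := eval_eq_zero_of_aeval_eq_zero (QMat.map Φ G) (1 - p) h1.symm ν (hFG ▸ hν)
    simp [hp0] at this

end

section
variable {I E : Type} [Fintype I] {s t : E → I} {α : I → ℕ}
variable {k : Type} [Field k] {S : Type} [CommRing S] [Algebra k S] (ρ : S →ₐ[k] k)

/-- `QMat.map` along an algebra homomorphism. -/
def QMat.mapAlgHom {I : Type} {α : I → ℕ} {k S T : Type} [CommRing k] [CommRing S] [CommRing T]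
    [Algebra k S] [Algebra k T] (f : S →ₐ[k] T) : QMat I α S →ₐ[k] QMat I α T where
  toRingHom := QMat.map f.toRingHom
  commutes' c := by
    funext i
    exact (f.mapMatrix (m := Fin (α i))).commutes c

theorem map_tensorAug_mem_span (K : Type) [Field K] [Algebra k K] (M : QRep I E s t α S)
    (e : QMat I α (S ⊗[k] K))
    (he : e ∈ endAlg s t α (S ⊗[k] K) fun a => (M a).map (algebraMap S (S ⊗[k] K))) :
    QMat.map (tensorAug ρ K).toRingHom e ∈ Submodule.span K
      (QMat.map (algebraMap k K) ''
        ((endAlg s t α k M).map (QMat.mapAlgHom ρ) : Set (QMat I α k))) := by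
  classical
  let b := Module.Basis.ofVectorSpace k K
  let bS := Algebra.TensorProduct.basis S b
  let X : _ → QMat I α S := fun j i r c => bS.repr (e i r c) j
  have hX : ∀ j, X j ∈ endAlg s t α k M := by
    intro j a
    ext r c
    have h := congrArg (fun z => bS.repr z j) (congrFun (congrFun (he a) r) c)
    simp only [Matrix.mul_apply, Matrix.map_apply, map_sum, Finsupp.coe_finsetSum,
      Finset.sum_apply] at h
    have h1 : ∀ (m : S) (z : S ⊗[k] K), algebraMap S (S ⊗[k] K) m * z = m • z :=
      fun m z => (Algebra.smul_def m z).symm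
    simp only [mul_comm _ (algebraMap S (S ⊗[k] K) _), h1, map_smul, Finsupp.smul_apply,
      smul_eq_mul] at h
    rw [Matrix.mul_apply, Matrix.mul_apply]
    simp only [mul_comm _ (M a _ _)]
    simpa only [mul_comm _ (M a _ _)] using h
  let J : Finset _ := Finset.univ.biUnion fun i : I => Finset.univ.biUnion fun r : Fin (α i) =>
    Finset.univ.biUnion fun c : Fin (α i) => (bS.repr (e i r c)).support
  have hJ : ∀ i r c, (bS.repr (e i r c)).support ⊆ J := by
    intro i r c j hj
    simp only [J, Finset.mem_biUnion, Finset.mem_univ, true_and]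
    exact ⟨i, r, c, hj⟩
  have hsum : QMat.map (tensorAug ρ K).toRingHom e =
      ∑ j ∈ J, b j • QMat.map (algebraMap k K) (QMat.mapAlgHom ρ (X j)) := by
    funext i
    ext r c
    have h1 : e i r c = ∑ j ∈ J, bS.repr (e i r c) j • bS j := by
      conv_lhs => rw [← bS.linearCombination_repr (e i r c), Finsupp.linearCombination_apply]
      exact Finsupp.sum_of_support_subset _ (hJ i r c) _ (by simp)
    have h2 : tensorAug ρ K (e i r c) = ∑ j ∈ J, b j * algebraMap k K (ρ (X j i r c)) := by
      rw [h1, map_sum]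
      refine Finset.sum_congr rfl fun j _ => ?_
      rw [Algebra.TensorProduct.basis_apply, TensorProduct.smul_tmul', smul_eq_mul, mul_one,
        tensorAug_tmul, mul_comm]
    rw [Finset.sum_apply, Matrix.sum_apply]
    exact h2
  rw [hsum]
  exact Submodule.sum_mem _ fun j _ => Submodule.smul_mem _ _
    (Submodule.subset_span ⟨_, ⟨X j, hX j, rfl⟩, rfl⟩)

theorem QAbsInd_of_forall [Finite k] (hρ : ∀ x, ρ x = 0 → IsNilpotent x) (ψ : k → ℂ)
    (hψ : ∀ (c : k) (m : ℕ), ψ (c ^ m) = ψ c ^ m)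
    (hn : (∑ i, α i) = 0 ∨ ((∑ i, α i : ℕ) : k) ≠ 0) (c : k) (hc0 : c ≠ 0)
    (hc : ∀ m, 0 < m → m < ∑ i, α i → ψ c ^ m ≠ 1)
    (M : QRep I E s t α S)
    (h : ∀ x ∈ endAlg s t α k M, piDet (QMat.map ρ.toRingHom x) ≠ 0 →
      ψ (piDet (QMat.map ρ.toRingHom x)) = 1) :
    QAbsInd k s t α S M := by
  rw [QAbsInd]
  have := isLocalRing_tensor ρ hρ (AlgebraicClosure k)
  rw [QDecomposable_iff_exists_idempotent]
  rintro ⟨e, heM, he, h0, h1⟩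
  rcases Nat.eq_zero_or_pos (∑ i, α i) with hn0 | hpos
  · apply h0
    funext i
    ext r
    have := r.2
    have h2 := Finset.sum_eq_zero_iff.mp hn0 i (Finset.mem_univ i)
    omega
  have hnk := hn.resolve_left hpos.ne'
  have hB : ∀ x ∈ (endAlg s t α k M).map (QMat.mapAlgHom ρ), piDet x ≠ 0 → ψ (piDet x) = 1 := by
    rintro _ ⟨x, hx, rfl⟩ hdet
    exact h x hx hdet
  have hspan := map_tensorAug_mem_span ρ (AlgebraicClosure k) M e heM
  have he' : IsIdempotentElem (QMat.map (tensorAug ρ (AlgebraicClosure k)).toRingHom e) :=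
    he.map _
  have hz : ∀ f : QMat I α (S ⊗[k] AlgebraicClosure k), IsIdempotentElem f →
      QMat.map (tensorAug ρ (AlgebraicClosure k)).toRingHom f = 0 → f = 0 := by
    intro f hf hf0
    obtain ⟨l, hl⟩ := QMat.isNilpotent_of_map_eq_zero _
      (fun z hz => isNilpotent_of_tensorAug_eq_zero ρ hρ _ z hz) f hf0
    rw [← hf.pow_succ_eq l, pow_succ, hl, zero_mul]
  rcases eq_zero_or_one_of_isIdempotent_of_mem_span hnk _
    (exists_isNilpotent_sub_algebraMap ψ hψ hpos c hc0 hc _ hB) _ he' hspan with h2 | h2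
  · exact h0 (hz e he h2)
  · apply h1
    refine (sub_eq_zero.mp (hz (1 - e) he.one_sub ?_)).symm
    rw [map_sub, map_one, h2, sub_self]

omit [Field k] [Algebra k S] in
theorem IsUnit.piDet {x : QMat I α S} (h : IsUnit x) : IsUnit (piDet x) := by
  obtain ⟨u, rfl⟩ := h
  exact IsUnit.of_mul_eq_one (_root_.piDet u.inv) (by rw [← piDet_mul, u.val_inv, piDet_one])

/-- Absolute indecomposability is detected by a character of order the total rank. -/
theorem qAbsInd_iff [Finite k] (hρ : ∀ x, ρ x = 0 → IsNilpotent x) (ψ : MulChar k ℂ)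
    (hn : (∑ i, α i) = 0 ∨ ((∑ i, α i : ℕ) : k) ≠ 0)
    (hψn : ∀ a : k, a ^ (∑ i, α i) ≠ 0 → ψ (a ^ ∑ i, α i) = 1) (c : k) (hc0 : c ≠ 0)
    (hc : ∀ m, 0 < m → m < ∑ i, α i → ψ c ^ m ≠ 1)
    (M : QRep I E s t α S) :
    QAbsInd k s t α S M ↔ ∀ g : QGl I α S, QAct s t α g M = M →
      ψ (piDet (QMat.map ρ.toRingHom fun i => (g i).val)) = 1 := by
  constructor
  · intro hM g hg
    by_contra hne
    refine not_QAbsInd_of_not_pow ρ hρ hn M _ ((QAct_eq_self_iff g M).mp hg) ?_ hM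
    rintro ⟨a, ha⟩
    have hu : IsUnit (fun i => (g i).val : QMat I α S) := Pi.isUnit_iff.mpr fun i => (g i).isUnit
    refine hne (ha ▸ hψn a (ha ▸ (hu.map (QMat.map ρ.toRingHom)).piDet.ne_zero))
  · intro h
    refine QAbsInd_of_forall ρ hρ ψ (fun c m => map_pow ψ c m) hn c hc0 hc M fun x hx hdet => ?_
    have hu : IsUnit x := by
      refine isUnit_of_isUnit_piDet (isUnit_of_augmentation_ne_zero ρ hρ ?_)
      rwa [piDet_map] at hdet
    rw [Pi.isUnit_iff] at hu
    exact h (fun i => (hu i).unit) ((QAct_eq_self_iff _ _).mpr hx)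

end

section
open Finset

/-- A weighted orbit-counting lemma: orbits of points whose stabilizer is killed by `f`. -/
theorem card_orbits_mul_card_eq_sum {G X : Type} [Group G] [Fintype G] [Fintype X] (act : G → X → X)
    (act_one : ∀ x, act 1 x = x) (act_mul : ∀ g h x, act (g * h) x = act g (act h x))
    (f : G →* ℂ) (P : X → Prop) (hP : ∀ g x, P x → P (act g x)) :
    (Nat.card {O : Set X // ∃ x, P x ∧ (∀ g, act g x = x → f g = 1) ∧
        O = {y | ∃ g, y = act g x}} : ℂ) * Nat.card G =
      ∑ g, f g * Nat.card {x // P x ∧ act g x = x} := by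
  classical
  let _ : MulAction G X := { smul := act, one_smul := act_one, mul_smul := act_mul }
  set Good : X → Prop := fun x => P x ∧ ∀ g, act g x = x → f g = 1 with hGood
  have hGoodAct : ∀ g x, Good x → Good (act g x) := by
    rintro g x ⟨h1, h2⟩
    refine ⟨hP g x h1, fun h hh => ?_⟩
    have h3 := congrArg (act g⁻¹) hh
    rw [← act_mul, ← act_mul, ← act_mul, inv_mul_cancel, act_one] at h3
    have h4 := h2 _ h3
    rw [map_mul, map_mul, mul_right_comm, ← map_mul, inv_mul_cancel, map_one, one_mul] at h4
    exact h4
  have hstab : ∀ x, P x → ∑ g, f g * (if act g x = x then 1 else 0) =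
      if Good x then (Nat.card (MulAction.stabilizer G x) : ℂ) else 0 := by
    intro x hx
    have h1 := sum_hom_units (f.comp (MulAction.stabilizer G x).subtype)
    have h2 : ∑ g, f g * (if act g x = x then 1 else 0) =
        ∑ g : MulAction.stabilizer G x, f.comp (MulAction.stabilizer G x).subtype g := by
      simp only [mul_ite, mul_one, mul_zero]
      rw [← Finset.sum_filter]
      exact Finset.sum_subtype _ (fun g => by simp [MulAction.mem_stabilizer_iff]; rfl) _
    have h3 : f.comp (MulAction.stabilizer G x).subtype = 1 ↔ Good x := by
      rw [DFunLike.ext_iff]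
      exact ⟨fun h => ⟨hx, fun g hg => h ⟨g, hg⟩⟩, fun h g => h.2 g g.2⟩
    rw [h2, h1, Nat.card_eq_fintype_card]
    simp only [h3]
    push_cast
    rfl
  have hR : ∑ g, f g * (Nat.card {x // P x ∧ act g x = x} : ℂ) =
      ∑ x with Good x, (Nat.card (MulAction.stabilizer G x) : ℂ) := by
    have h1 : ∀ g, (Nat.card {x // P x ∧ act g x = x} : ℂ) =
        ∑ x with P x, if act g x = x then 1 else 0 := by
      intro g
      rw [Nat.card_eq_fintype_card, Fintype.card_subtype, ← Finset.filter_filter]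
      simp
    simp only [h1, Finset.mul_sum]
    rw [Finset.sum_comm, Finset.sum_congr rfl fun x hx => hstab x (by simpa using hx),
      ← Finset.sum_filter, Finset.filter_filter]
    refine Finset.sum_congr ?_ fun _ _ => rfl
    ext x
    simp [hGood]
  rw [hR]
  have hset : ∀ O : Set X, (∃ x, P x ∧ (∀ g, act g x = x → f g = 1) ∧
        O = {y | ∃ g, y = act g x}) ↔ O ∈ (univ.filter Good).image (MulAction.orbit G) := by
    intro O
    simp only [Finset.mem_image, Finset.mem_filter, Finset.mem_univ, true_and, hGood, and_assoc]
    refine exists_congr fun x => and_congr_right fun _ => and_congr_right fun _ => ?_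
    have : MulAction.orbit G x = {y | ∃ g, y = act g x} := by
      ext y
      exact exists_congr fun g => eq_comm
    rw [this, eq_comm]
  have hcard : Nat.card {O : Set X // ∃ x, P x ∧ (∀ g, act g x = x → f g = 1) ∧
        O = {y | ∃ g, y = act g x}} = ((univ.filter Good).image (MulAction.orbit G)).card := by
    rw [Nat.card_congr (Equiv.subtypeEquivRight hset), Nat.card_eq_fintype_card, Fintype.card_coe]
  rw [hcard, ← Finset.sum_fiberwise_of_maps_to
    (fun x hx => Finset.mem_image_of_mem (MulAction.orbit G) hx), ← nsmul_eq_mul,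
    ← Finset.sum_const]
  refine Finset.sum_congr rfl fun O hO => ?_
  obtain ⟨x, hx, rfl⟩ := Finset.mem_image.mp hO
  have hx' : Good x := by simpa using hx
  have h1 : ∀ y ∈ (univ.filter Good).filter (fun y => MulAction.orbit G y = MulAction.orbit G x),
      Nat.card (MulAction.stabilizer G y) = Nat.card (MulAction.stabilizer G x) := by
    intro y hy
    refine Nat.card_congr (MulAction.stabilizerEquivStabilizerOfOrbitRel ?_).toEquiv
    rw [MulAction.orbitRel_apply, ← MulAction.orbit_eq_iff]
    exact (Finset.mem_filter.mp hy).2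
  rw [Finset.sum_congr rfl fun y hy => congrArg (Nat.cast : ℕ → ℂ) (h1 y hy), Finset.sum_const,
    nsmul_eq_mul]
  have h5 : ((univ.filter Good).filter
      (fun y => MulAction.orbit G y = MulAction.orbit G x)).card =
      Fintype.card (MulAction.orbit G x) := by
    rw [← Set.toFinset_card]
    congr 1
    ext y
    simp only [Finset.mem_filter, Finset.mem_univ, true_and, Set.mem_toFinset,
      MulAction.orbit_eq_iff]
    refine ⟨fun h => h.2, fun h => ⟨?_, h⟩⟩
    obtain ⟨g, rfl⟩ := h
    exact hGoodAct g x hx'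
  rw [h5, ← Nat.cast_mul, Nat.card_eq_fintype_card, Nat.card_eq_fintype_card,
    MulAction.card_orbit_mul_card_stabilizer_eq_card_group]

end

theorem card_ker_mul_card_eq {k V W W' : Type} [Field k] [Finite k] [AddCommGroup V] [Module k V]
    [Module.Finite k V] [AddCommGroup W] [Module k W] [Module.Finite k W] [AddCommGroup W']
    [Module k W'] [Module.Finite k W'] (B : W' →ₗ[k] Module.Dual k W) (hB : Function.Injective B)
    (hdim : Module.finrank k W' = Module.finrank k W) (L : V →ₗ[k] W) :
    Nat.card {v : V // L v = 0} * Nat.card W =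
      Nat.card V * Nat.card {n : W' // ∀ v, B n (L v) = 0} := by
  have hsurj : Function.Surjective B := by
    refine (LinearMap.injective_iff_surjective_of_finrank_eq_finrank ?_).mp hB
    rw [hdim, Subspace.dual_finrank_eq]
  have h1 := LinearMap.finrank_range_add_finrank_ker L
  have h2 := LinearMap.finrank_range_add_finrank_ker (L.dualMap.comp B)
  have h3 : LinearMap.range (L.dualMap.comp B) = LinearMap.range L.dualMap := by
    rw [LinearMap.range_comp, LinearMap.range_eq_top.mpr hsurj, Submodule.map_top]
  rw [h3, LinearMap.finrank_range_dualMap_eq_finrank_range, hdim] at h2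
  have h4 : Nat.card {v : V // L v = 0} = Nat.card (LinearMap.ker L) := rfl
  have h5 : Nat.card {n : W' // ∀ v, B n (L v) = 0} =
      Nat.card (LinearMap.ker (L.dualMap.comp B)) := by
    refine Nat.card_congr (Equiv.subtypeEquivRight fun n => ?_)
    rw [LinearMap.mem_ker, LinearMap.ext_iff]
    rfl
  rw [h4, h5, Module.natCard_eq_pow_finrank (K := k) (V := LinearMap.ker L),
    Module.natCard_eq_pow_finrank (K := k) (V := W), Module.natCard_eq_pow_finrank (K := k) (V := V),
    Module.natCard_eq_pow_finrank (K := k) (V := LinearMap.ker (L.dualMap.comp B)), ← pow_add,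
    ← pow_add]
  congr 1
  omega

section
variable {k R : Type} [Field k] [CommRing R] [Algebra k R] (lam : R →ₗ[k] k)
  {J : Type} [Fintype J] {p q : J → ℕ}

/-- The trace pairing between families of matrices of transposed sizes. -/
def tracePairing : (∀ a, Matrix (Fin (p a)) (Fin (q a)) R) →ₗ[k]
    Module.Dual k (∀ a, Matrix (Fin (q a)) (Fin (p a)) R) :=
  LinearMap.mk₂ k (fun N Y => ∑ a, lam (N a * Y a).trace)
    (by intro x y z; simp [Matrix.add_mul, Finset.sum_add_distrib])
    (by intro c x y; simp [Finset.mul_sum])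
    (by intro x y z; simp [Matrix.mul_add, Finset.sum_add_distrib])
    (by intro c x y; simp [Finset.mul_sum])

theorem tracePairing_apply (N : ∀ a, Matrix (Fin (p a)) (Fin (q a)) R)
    (Y : ∀ a, Matrix (Fin (q a)) (Fin (p a)) R) :
    tracePairing lam N Y = ∑ a, lam (N a * Y a).trace := rfl

theorem tracePairing_injective (hlam : ∀ J : Ideal R, J ≠ ⊥ → ∃ x ∈ J, lam x ≠ 0) :
    Function.Injective (tracePairing lam (p := p) (q := q)) := by
  classical
  rw [injective_iff_map_eq_zero]
  intro N hN
  funext a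
  ext i j
  by_contra hne
  obtain ⟨x, hx, hx0⟩ := hlam (Ideal.span {N a i j}) (by simpa using hne)
  obtain ⟨y, rfl⟩ := Ideal.mem_span_singleton'.mp hx
  apply hx0
  have h := LinearMap.congr_fun hN (Pi.single a (Matrix.single j i y))
  rw [tracePairing_apply, Finset.sum_eq_single a] at h
  · simpa [Matrix.trace_mul_single, mul_comm] using h
  · intro b _ hb
    rw [Pi.single_eq_of_ne hb, Matrix.mul_zero, Matrix.trace_zero, map_zero]
  · simp

end

section
variable {I E : Type} [DecidableEq I] [Fintype I] [Fintype E] {s t : E → I} {α : I → ℕ}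
  {R : Type} [CommRing R]

theorem sum_trace_momentMapD_mul
    (N : QRep I (E ⊕ E) (Sum.elim s t) (Sum.elim t s) α R) (η : QMat I α R)
    (M : QRep I E s t α R) (M' : QRep I E t s α R) (hM : ∀ a, N (Sum.inl a) = M a)
    (hM' : ∀ a, N (Sum.inr a) = M' a) :
    ∑ i, (momentMapD I E s t α R N i * η i).trace =
      ∑ a, ((M a * M' a * η (t a)).trace - (M' a * M a * η (s a)).trace) := by
  have key : ∀ (u : E → I) (X : ∀ a, Matrix (Fin (α (u a))) (Fin (α (u a))) R),
      ∑ i, ((∑ a : E, if h : u a = i then (X a).submatrix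
        (finCongr (congrArg α h.symm)) (finCongr (congrArg α h.symm)) else 0) * η i).trace =
      ∑ a, (X a * η (u a)).trace := by
    intro u X
    simp only [Finset.sum_mul, Matrix.trace_sum]
    rw [Finset.sum_comm]
    refine Finset.sum_congr rfl fun a _ => ?_
    rw [Finset.sum_eq_single (u a)]
    · rw [dif_pos rfl]
      rfl
    · intro b _ hb
      rw [dif_neg hb.symm, zero_mul, Matrix.trace_zero]
    · simp
  rw [Finset.sum_sub_distrib, ← key t fun a => M a * M' a, ← key s fun a => M' a * M a,
    ← Finset.sum_sub_distrib]
  refine Finset.sum_congr rfl fun i _ => ?_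
  rw [← Matrix.trace_sub, ← sub_mul, momentMapD]
  have h1 : (fun a => N (Sum.inl a)) = M := funext hM
  have h2 : (fun a => N (Sum.inr a)) = M' := funext hM'
  subst h1 h2
  rfl

variable {k : Type} [Field k] [Algebra k R] (lam : R →ₗ[k] k)

/-- The linear map whose kernel is the space of first-order deformations `(η, Y)` of
the relation `g M = M g`. -/
def deformMap (k : Type) [Field k] [Algebra k R] (g : QMat I α R) (M : QRep I E s t α R) :
    (QMat I α R × QRep I E s t α R) →ₗ[k] QRep I E s t α R where
  toFun v a := g (t a) * v.2 a + v.1 (t a) * M a - (v.2 a * g (s a) + M a * v.1 (s a))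
  map_add' v w := by
    funext a
    simp only [Prod.fst_add, Prod.snd_add, Pi.add_apply, Matrix.mul_add, Matrix.add_mul]
    abel
  map_smul' c v := by
    funext a
    simp [Matrix.mul_smul, Matrix.smul_mul, smul_sub, smul_add]

theorem tracePairing_deformMap_eq_zero_iff
    (hlam : ∀ J : Ideal R, J ≠ ⊥ → ∃ x ∈ J, lam x ≠ 0) (g : QMat I α R) (M : QRep I E s t α R)
    (M' : QRep I E t s α R) (N : QRep I (E ⊕ E) (Sum.elim s t) (Sum.elim t s) α R)
    (hM : ∀ a, N (Sum.inl a) = M a) (hM' : ∀ a, N (Sum.inr a) = M' a) :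
    (∀ v, tracePairing lam M' (deformMap k g M v) = 0) ↔
      (∀ i, momentMapD I E s t α R N i = 0) ∧ ∀ a, g (s a) * M' a = M' a * g (t a) := by
  have h1 : ∀ η : QMat I α R, tracePairing lam M' (deformMap k g M (η, 0)) =
      tracePairing lam (momentMapD I E s t α R N) η := by
    intro η
    rw [tracePairing_apply, tracePairing_apply, ← map_sum, ← map_sum,
      sum_trace_momentMapD_mul N η M M' hM hM']
    congr 1
    refine Finset.sum_congr rfl fun a _ => ?_
    have : deformMap k g M (η, 0) a = η (t a) * M a - M a * η (s a) := by
      simp [deformMap]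
    rw [this, Matrix.mul_sub, Matrix.trace_sub, Matrix.trace_mul_cycle' (M' a),
      ← Matrix.mul_assoc, ← Matrix.mul_assoc]
  have h2 : ∀ Y, tracePairing lam M' (deformMap k g M (0, Y)) =
      tracePairing lam (fun a => M' a * g (t a) - g (s a) * M' a) Y := by
    intro Y
    rw [tracePairing_apply, tracePairing_apply]
    refine Finset.sum_congr rfl fun a _ => ?_
    have : deformMap k g M (0, Y) a = g (t a) * Y a - Y a * g (s a) := by
      simp [deformMap]
    rw [this, Matrix.mul_sub, Matrix.sub_mul, Matrix.trace_sub, Matrix.trace_sub,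
      Matrix.mul_assoc, Matrix.mul_assoc, Matrix.trace_mul_cycle' (g (s a)),
      Matrix.trace_mul_cycle' (Y a)]
  have h3 : (∀ v, tracePairing lam M' (deformMap k g M v) = 0) ↔
      (∀ η, tracePairing lam M' (deformMap k g M (η, 0)) = 0) ∧
        ∀ Y, tracePairing lam M' (deformMap k g M (0, Y)) = 0 := by
    refine ⟨fun h => ⟨fun η => h _, fun Y => h _⟩, fun ⟨hη, hY⟩ v => ?_⟩
    have : v = (v.1, 0) + (0, v.2) := by simp
    rw [this, map_add, map_add, hη, hY, add_zero]
  rw [h3]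
  simp only [h1, h2]
  refine and_congr ⟨fun h i => ?_, fun h η => ?_⟩ ⟨fun h a => ?_, fun h Y => ?_⟩
  · exact congrFun (tracePairing_injective lam hlam
      ((LinearMap.ext h).trans (map_zero (tracePairing lam)).symm)) i
  · rw [show momentMapD I E s t α R N = 0 from funext h, map_zero, LinearMap.zero_apply]
  · exact (sub_eq_zero.mp (congrFun (tracePairing_injective lam hlam
      ((LinearMap.ext h).trans (map_zero (tracePairing lam)).symm)) a)).symm
  · rw [show (fun a => M' a * g (t a) - g (s a) * M' a) = 0 from
      funext fun a => sub_eq_zero.mpr (h a).symm, map_zero, LinearMap.zero_apply]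

omit [DecidableEq I] in
theorem card_deform_eq [Finite k] [Module.Finite k R]
    (hlam : ∀ J : Ideal R, J ≠ ⊥ → ∃ x ∈ J, lam x ≠ 0) (g : QMat I α R) (M : QRep I E s t α R) :
    Nat.card {v // deformMap k g M v = 0} = Nat.card (QMat I α R) *
      Nat.card {M' : QRep I E t s α R // ∀ v, tracePairing lam M' (deformMap k g M v) = 0} := by
  have hfin : Finite R := Module.finite_of_finite k
  have hdim : Module.finrank k (QRep I E t s α R) = Module.finrank k (QRep I E s t α R) :=
    LinearEquiv.finrank_eq
      (LinearEquiv.piCongrRight fun a =>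
        Matrix.transposeLinearEquiv (Fin (α (s a))) (Fin (α (t a))) k R)
  have h := card_ker_mul_card_eq (tracePairing lam) (tracePairing_injective lam hlam) hdim
    (deformMap k g M)
  rw [Nat.card_prod, mul_right_comm] at h
  exact Nat.eq_of_mul_eq_mul_right Nat.card_pos h

end

section
variable {I E : Type} {s t : E → I} {α : I → ℕ} {S : Type} [CommRing S]

theorem QAct_one (M : QRep I E s t α S) : QAct s t α 1 M = M := by
  rw [QAct_eq_iff]
  intro a
  change 1 * M a = M a * 1
  rw [Matrix.one_mul, Matrix.mul_one]

theorem QAct_mul (g h : QGl I α S) (M : QRep I E s t α S) :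
    QAct s t α (g * h) M = QAct s t α g (QAct s t α h M) := by
  rw [QAct_eq_iff]
  intro a
  change (g (t a)).val * (h (t a)).val * M a =
    (g (t a)).val * ((h (t a)).val * M a * (h (s a)).inv) * (g (s a)).inv *
      ((g (s a)).val * (h (s a)).val)
  rw [← Matrix.mul_assoc _ (g (s a)).val, Matrix.mul_assoc _ (g (s a)).inv, Units.inv_val,
    Matrix.mul_one]
  simp only [Matrix.mul_assoc]
  rw [Units.inv_val, Matrix.mul_one]

theorem momentMapD_QAct [DecidableEq I] [Fintype E] (g : QGl I α S)
    (N : QRep I (E ⊕ E) (Sum.elim s t) (Sum.elim t s) α S) (i : I) :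
    momentMapD I E s t α S (QAct (Sum.elim s t) (Sum.elim t s) α g N) i =
      (g i).val * momentMapD I E s t α S N i * (g i).inv := by
  have key : ∀ (u : E → I) (X Y : ∀ a, Matrix (Fin (α (u a))) (Fin (α (u a))) S),
      (∀ a, Y a = (g (u a)).val * X a * (g (u a)).inv) →
      ∑ a : E, (if h : u a = i then (Y a).submatrix
        (finCongr (congrArg α h.symm)) (finCongr (congrArg α h.symm)) else 0) =
      (g i).val * (∑ a : E, if h : u a = i then (X a).submatrix
        (finCongr (congrArg α h.symm)) (finCongr (congrArg α h.symm)) else 0) * (g i).inv := by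
    intro u X Y hXY
    rw [Finset.mul_sum, Finset.sum_mul]
    refine Finset.sum_congr rfl fun a _ => ?_
    by_cases h : u a = i
    · subst h
      rw [dif_pos rfl, dif_pos rfl]
      exact hXY a
    · rw [dif_neg h, dif_neg h, Matrix.mul_zero, Matrix.zero_mul]
  have cancel : ∀ {l m n : ℕ} (u : (Matrix (Fin m) (Fin m) S)ˣ) (A : Matrix (Fin l) (Fin l) S)
      (X : Matrix (Fin l) (Fin m) S) (Y : Matrix (Fin m) (Fin n) S) (B : Matrix (Fin n) (Fin n) S),
      A * X * u.inv * (u.val * Y * B) = A * (X * Y) * B := by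
    intro l m n u A X Y B
    rw [← Matrix.mul_assoc, ← Matrix.mul_assoc, Matrix.mul_assoc _ u.inv, Units.inv_val,
      Matrix.mul_one, Matrix.mul_assoc A]
  rw [momentMapD, momentMapD, mul_sub, sub_mul]
  congr 1
  · exact key t _ _ fun a => cancel (g (s a)) (g (t a)).val (N (Sum.inl a)) (N (Sum.inr a)) _
  · exact key s _ _ fun a => cancel (g (t a)) (g (s a)).val (N (Sum.inr a)) (N (Sum.inl a)) _

variable [Fintype I] {k : Type} [Field k] [Algebra k S]

/-- The character of `G_α(S)` obtained from a character of the residue field. -/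
noncomputable def detChar (ρ : S →ₐ[k] k) (ψ : MulChar k ℂ) : QGl I α S →* ℂ where
  toFun g := ψ (piDet (QMat.map ρ.toRingHom fun i => (g i).val))
  map_one' := by
    have : (fun i => ((1 : QGl I α S) i).val) = (1 : QMat I α S) := rfl
    rw [this, map_one, piDet_one, map_one]
  map_mul' g h := by
    have : (fun i => ((g * h) i).val) =
      ((fun i => (g i).val) * fun i => (h i).val : QMat I α S) := rfl
    rw [this, map_mul, piDet_mul, map_mul]

theorem card_absInd_orbits_mul_card [Finite E] [Finite k] [Finite S] [Fintype (QGl I α S)]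
    (ρ : S →ₐ[k] k) (hρ : ∀ x, ρ x = 0 → IsNilpotent x) (ψ : MulChar k ℂ)
    (hn : (∑ i, α i) = 0 ∨ ((∑ i, α i : ℕ) : k) ≠ 0)
    (hψn : ∀ a : k, a ^ (∑ i, α i) ≠ 0 → ψ (a ^ ∑ i, α i) = 1) (c : k) (hc0 : c ≠ 0)
    (hc : ∀ m, 0 < m → m < ∑ i, α i → ψ c ^ m ≠ 1)
    (P : QRep I E s t α S → Prop) (hP : ∀ g M, P M → P (QAct s t α g M)) :
    (Nat.card {O : Set (QRep I E s t α S) // ∃ M, P M ∧ QAbsInd k s t α S M ∧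
        O = {N | ∃ g, N = QAct s t α g M}} : ℂ) * Nat.card (QGl I α S) =
      ∑ g, detChar ρ ψ g * Nat.card {M // P M ∧ QAct s t α g M = M} := by
  have := Fintype.ofFinite (QRep I E s t α S)
  rw [← card_orbits_mul_card_eq_sum (QAct s t α) QAct_one QAct_mul (detChar ρ ψ) P hP,
    Nat.card_congr (Equiv.subtypeEquivRight fun O => ?_)]
  refine exists_congr fun M => and_congr_right fun _ => and_congr_left fun _ => ?_
  exact qAbsInd_iff ρ hρ ψ hn hψn c hc0 hc M

end

section
variable {I E : Type} {s t : E → I} {α : I → ℕ} {R : Type} [CommRing R]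

/-- Representations of the double quiver are pairs of representations of opposite quivers. -/
def QRep.doubleEquiv : QRep I (E ⊕ E) (Sum.elim s t) (Sum.elim t s) α R ≃
    QRep I E s t α R × QRep I E t s α R where
  toFun N := (fun a => N (Sum.inl a), fun a => N (Sum.inr a))
  invFun Z := Sum.rec Z.1 Z.2
  left_inv N := funext fun a => by cases a <;> rfl
  right_inv _ := rfl

theorem momentMapD_eq_zero_and_fixed_iff [DecidableEq I] [Fintype I] [Fintype E] {k : Type}
    [Field k] [Algebra k R] (lam : R →ₗ[k] k)
    (hlam : ∀ J : Ideal R, J ≠ ⊥ → ∃ x ∈ J, lam x ≠ 0) (g : QGl I α R)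
    (N : QRep I (E ⊕ E) (Sum.elim s t) (Sum.elim t s) α R) :
    ((∀ i, momentMapD I E s t α R N i = 0) ∧ QAct (Sum.elim s t) (Sum.elim t s) α g N = N) ↔
      QAct s t α g (QRep.doubleEquiv N).1 = (QRep.doubleEquiv N).1 ∧
        ∀ v, tracePairing lam (QRep.doubleEquiv N).2
          (deformMap k (fun i => (g i).val) (QRep.doubleEquiv N).1 v) = 0 := by
  rw [tracePairing_deformMap_eq_zero_iff lam hlam _ (QRep.doubleEquiv N).1 (QRep.doubleEquiv N).2 N
    (fun _ => rfl) (fun _ => rfl), QAct_eq_iff, QAct_eq_iff, Sum.forall, and_left_comm]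
  rfl

theorem card_sigma_deform_eq [DecidableEq I] [Fintype I] [Fintype E] {k : Type} [Field k]
    [Algebra k R] [Finite k] [Module.Finite k R] (lam : R →ₗ[k] k)
    (hlam : ∀ J : Ideal R, J ≠ ⊥ → ∃ x ∈ J, lam x ≠ 0) (g : QGl I α R) :
    Nat.card (Σ η : QMat I α R, {Z : QRep I E s t α R × QRep I E s t α R //
        QAct s t α g Z.1 = Z.1 ∧ deformMap k (fun i => (g i).val) Z.1 (η, Z.2) = 0}) =
      Nat.card (QMat I α R) *
        Nat.card {N : QRep I (E ⊕ E) (Sum.elim s t) (Sum.elim t s) α R //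
          (∀ i, momentMapD I E s t α R N i = 0) ∧
            QAct (Sum.elim s t) (Sum.elim t s) α g N = N} := by
  have hfin : Finite R := Module.finite_of_finite k
  have := Fintype.ofFinite {M : QRep I E s t α R // QAct s t α g M = M}
  let x : QMat I α R := fun i => (g i).val
  have h1 : Nat.card (Σ η : QMat I α R, {Z : QRep I E s t α R × QRep I E s t α R //
        QAct s t α g Z.1 = Z.1 ∧ deformMap k x Z.1 (η, Z.2) = 0}) =
      Nat.card (Σ M : {M : QRep I E s t α R // QAct s t α g M = M},
        {v // deformMap k x M.1 v = 0}) :=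
    Nat.card_congr
    { toFun := fun z => ⟨⟨z.2.1.1, z.2.2.1⟩, ⟨(z.1, z.2.1.2), z.2.2.2⟩⟩
      invFun := fun z => ⟨z.2.1.1, ⟨(z.1.1, z.2.1.2), z.1.2, z.2.2⟩⟩
      left_inv := fun _ => rfl
      right_inv := fun _ => rfl }
  have h2 : Nat.card {Z : QRep I E s t α R × QRep I E t s α R // QAct s t α g Z.1 = Z.1 ∧
        ∀ v, tracePairing lam Z.2 (deformMap k x Z.1 v) = 0} =
      Nat.card (Σ M : {M : QRep I E s t α R // QAct s t α g M = M},
        {M' : QRep I E t s α R // ∀ v, tracePairing lam M' (deformMap k x M.1 v) = 0}) :=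
    Nat.card_congr
    { toFun := fun Z => ⟨⟨Z.1.1, Z.2.1⟩, ⟨Z.1.2, Z.2.2⟩⟩
      invFun := fun z => ⟨(z.1.1, z.2.1), z.1.2, z.2.2⟩
      left_inv := fun _ => rfl
      right_inv := fun _ => rfl }
  have h3 : Nat.card {N : QRep I (E ⊕ E) (Sum.elim s t) (Sum.elim t s) α R //
          (∀ i, momentMapD I E s t α R N i = 0) ∧
            QAct (Sum.elim s t) (Sum.elim t s) α g N = N} =
      Nat.card {Z : QRep I E s t α R × QRep I E t s α R // QAct s t α g Z.1 = Z.1 ∧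
        ∀ v, tracePairing lam Z.2 (deformMap k x Z.1 v) = 0} :=
    Nat.card_congr (QRep.doubleEquiv.subtypeEquiv (momentMapD_eq_zero_and_fixed_iff lam hlam g))
  refine h1.trans ?_
  rw [h3, h2, Nat.card_sigma, Nat.card_sigma, Finset.mul_sum]
  exact Finset.sum_congr rfl fun M _ => card_deform_eq lam hlam x M.1

theorem matrix_fst_mul {l m n : ℕ} (A : Matrix (Fin l) (Fin m) (DualNumber R))
    (B : Matrix (Fin m) (Fin n) (DualNumber R)) :
    (A * B).map TrivSqZeroExt.fst = A.map TrivSqZeroExt.fst * B.map TrivSqZeroExt.fst := by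
  ext i j
  simp [Matrix.mul_apply, TrivSqZeroExt.fst_sum]

theorem matrix_snd_mul {l m n : ℕ} (A : Matrix (Fin l) (Fin m) (DualNumber R))
    (B : Matrix (Fin m) (Fin n) (DualNumber R)) :
    (A * B).map TrivSqZeroExt.snd = A.map TrivSqZeroExt.fst * B.map TrivSqZeroExt.snd +
      A.map TrivSqZeroExt.snd * B.map TrivSqZeroExt.fst := by
  ext i j
  simp [Matrix.mul_apply, TrivSqZeroExt.snd_sum, Finset.sum_add_distrib, mul_comm]

omit [CommRing R] in
theorem matrix_dualNumber_ext {m n : ℕ} {A B : Matrix (Fin m) (Fin n) (DualNumber R)} :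
    A = B ↔ A.map TrivSqZeroExt.fst = B.map TrivSqZeroExt.fst ∧
      A.map TrivSqZeroExt.snd = B.map TrivSqZeroExt.snd := by
  refine ⟨fun h => by rw [h]; exact ⟨rfl, rfl⟩, fun ⟨h1, h2⟩ => ?_⟩
  ext i j
  · exact congrFun (congrFun h1 i) j
  · exact congrFun (congrFun h2 i) j

/-- Representations over the dual numbers are pairs of representations. -/
def QRep.dualNumberEquiv :
    QRep I E s t α (DualNumber R) ≃ QRep I E s t α R × QRep I E s t α R where
  toFun X := (fun a => (X a).map TrivSqZeroExt.fst, fun a => (X a).map TrivSqZeroExt.snd)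
  invFun Z := fun a => Matrix.of fun i j => (Z.1 a i j, Z.2 a i j)
  left_inv _ := rfl
  right_inv _ := rfl

theorem QAct_dualNumber_iff (k : Type) [Field k] [Algebra k R] (g : QGl I α (DualNumber R))
    (h : QGl I α R) (hg : ∀ i, (h i).val = (g i).val.map TrivSqZeroExt.fst)
    (X : QRep I E s t α (DualNumber R)) :
    QAct s t α g X = X ↔ QAct s t α h (QRep.dualNumberEquiv X).1 = (QRep.dualNumberEquiv X).1 ∧
      deformMap k (fun i => (h i).val) (QRep.dualNumberEquiv X).1
        (fun i => (g i).val.map TrivSqZeroExt.snd, (QRep.dualNumberEquiv X).2) = 0 := by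
  rw [QAct_eq_iff, QAct_eq_iff, funext_iff, ← forall_and]
  refine forall_congr' fun a => ?_
  rw [matrix_dualNumber_ext, matrix_fst_mul, matrix_fst_mul, matrix_snd_mul, matrix_snd_mul,
    ← hg, ← hg]
  refine and_congr Iff.rfl ?_
  rw [← sub_eq_zero, add_comm (Matrix.map (X a) _ * _)]
  rfl

/-- Units of matrix algebras over the dual numbers. -/
noncomputable def QGl.dualNumberEquiv : QGl I α (DualNumber R) ≃ QGl I α R × QMat I α R :=
  Equiv.ofBijective
    (fun g => (fun i => Units.map (TrivSqZeroExt.fstHom R R R).toRingHom.mapMatrix.toMonoidHom (g i),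
      fun i => (g i).val.map TrivSqZeroExt.snd)) <| by
    constructor
    · intro g h hgh
      funext i
      refine Units.ext (matrix_dualNumber_ext.mpr ⟨?_, ?_⟩)
      · exact congrArg Units.val (congrFun (congrArg Prod.fst hgh) i)
      · exact congrFun (congrArg Prod.snd hgh) i
    · rintro ⟨g, η⟩
      let x : QMat I α (DualNumber R) := fun i => Matrix.of fun r c => ((g i).val r c, η i r c)
      have hx : ∀ i, (TrivSqZeroExt.fstHom R R R).toRingHom.mapMatrix (x i) = (g i).val :=
        fun i => rfl
      have hu : ∀ i, IsUnit (x i) := by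
        intro i
        rw [Matrix.isUnit_iff_isUnit_det, TrivSqZeroExt.isUnit_iff_isUnit_fst]
        have h1 := RingHom.map_det (TrivSqZeroExt.fstHom R R R).toRingHom (x i)
        rw [hx] at h1
        change IsUnit ((TrivSqZeroExt.fstHom R R R).toRingHom (x i).det)
        rw [h1, ← Matrix.isUnit_iff_isUnit_det]
        exact (g i).isUnit
      refine ⟨fun i => (hu i).unit, Prod.ext (funext fun i => Units.ext ?_) rfl⟩
      exact hx i

end

/-- The augmentation of a split local algebra. -/
theorem exists_augmentation {k R : Type} [Field k] [CommRing R] [Algebra k R]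
    [FiniteDimensional k R] [IsLocalRing R]
    (hsplit : Function.Bijective fun c : k => IsLocalRing.residue R (algebraMap k R c)) :
    ∃ ρ : R →ₐ[k] k, ∀ x, ρ x = 0 → IsNilpotent x := by
  have : IsArtinianRing R := IsArtinianRing.of_finite k R
  let e : k ≃ₐ[k] IsLocalRing.ResidueField R :=
    AlgEquiv.ofBijective (Algebra.ofId k _) hsplit
  refine ⟨e.symm.toAlgHom.comp (IsScalarTower.toAlgHom k R (IsLocalRing.ResidueField R)),
    fun x hx => ?_⟩
  have h1 : IsLocalRing.residue R x = 0 := by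
    have : e.symm (IsLocalRing.residue R x) = 0 := hx
    simpa using this
  rw [IsLocalRing.residue_eq_zero_iff] at h1
  obtain ⟨n, hn⟩ := IsArtinianRing.isNilpotent_jacobson_bot (R := R)
  rw [IsLocalRing.jacobson_eq_maximalIdeal ⊥ bot_ne_top] at hn
  exact ⟨n, by simpa [hn] using Ideal.pow_mem_pow h1 n⟩

/-- The augmentation of the dual numbers. -/
def dualNumberAug {k R : Type} [Field k] [CommRing R] [Algebra k R] (ρ : R →ₐ[k] k) :
    DualNumber R →ₐ[k] k :=
  ρ.comp (TrivSqZeroExt.fstHom k R R)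

theorem isNilpotent_of_dualNumberAug_eq_zero {k R : Type} [Field k] [CommRing R] [Algebra k R]
    (ρ : R →ₐ[k] k) (hρ : ∀ x, ρ x = 0 → IsNilpotent x) (x : DualNumber R)
    (hx : dualNumberAug ρ x = 0) : IsNilpotent x :=
  TrivSqZeroExt.isNilpotent_iff_isNilpotent_fst.mpr (hρ _ hx)

/-- A character whose kernel consists of the `n`-th powers, when there is a primitive `n`-th root
of unity. -/
theorem exists_mulChar_of_isPrimitiveRoot {k : Type} [Field k] [Fintype k] {n : ℕ} {ζ : k}
    (hζ : IsPrimitiveRoot ζ n) :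
    ∃ ψ : MulChar k ℂ, (∀ a : k, a ^ n ≠ 0 → ψ (a ^ n) = 1) ∧
      ∃ c : k, c ≠ 0 ∧ ∀ m, 0 < m → m < n → ψ c ^ m ≠ 1 := by
  rcases Nat.eq_zero_or_pos n with rfl | hn
  · exact ⟨1, fun a ha => by simp, 1, one_ne_zero, fun m _ hm => absurd hm (Nat.not_lt_zero m)⟩
  have hdvd : n ∣ Fintype.card k - 1 := by
    have h0 : ζ ≠ 0 := hζ.ne_zero hn.ne'
    rw [hζ.eq_orderOf]
    exact orderOf_dvd_of_pow_eq_one (FiniteField.pow_card_sub_one_eq_one ζ h0)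
  obtain ⟨ψ, hψ⟩ := MulChar.exists_mulChar_orderOf k hdvd (Complex.isPrimitiveRoot_exp n hn.ne')
  obtain ⟨c, hc⟩ := IsCyclic.exists_generator (α := kˣ)
  refine ⟨ψ, fun a ha => ?_, c, c.ne_zero, fun m hm0 hm h1 => ?_⟩
  · have ha0 : a ≠ 0 := by rintro rfl; simp [hn.ne'] at ha
    rw [map_pow, ← MulChar.pow_apply' ψ hn.ne', ← hψ, pow_orderOf_eq_one]
    exact MulChar.one_apply ha0.isUnit
  · have h2 : ψ ^ m = 1 := by
      rw [MulChar.eq_iff hc, MulChar.pow_apply_coe, h1, MulChar.one_apply_coe]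
    exact absurd (Nat.le_of_dvd hm0 (hψ ▸ orderOf_dvd_of_pow_eq_one h2)) (not_le.mpr hm)

theorem natCast_ne_zero_of_isPrimitiveRoot {k : Type} [Field k] [Fintype k] {n : ℕ} {ζ : k}
    (hζ : IsPrimitiveRoot ζ n) : n = 0 ∨ ((n : ℕ) : k) ≠ 0 := by
  rcases Nat.eq_zero_or_pos n with rfl | hn
  · exact Or.inl rfl
  · have : NeZero n := ⟨hn.ne'⟩
    have hne := hζ.neZero'
    exact Or.inr hne.out

/-- Over a finite field `k` containing a primitive `|α|`-th root of unity and a split local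
Frobenius `k`-algebra `R`, the number of isomorphism classes of absolutely indecomposable
locally free representations of the preprojective algebra `Π_R(Q)` of rank `α` equals the
number of isomorphism classes of absolutely indecomposable locally free representations of
`Q` of rank `α` over the dual numbers `R[ε]`. -/
theorem abs_indec_preprojective_orbits_eq_dual_number_orbits
    (k : Type) [Field k] [Fintype k]
    (R : Type) [CommRing R] [Algebra k R] [FiniteDimensional k R] [IsLocalRing R]
    (hsplit : Function.Bijective fun c : k => IsLocalRing.residue R (algebraMap k R c))
    (lam : R →ₗ[k] k) (hlam : ∀ J : Ideal R, J ≠ ⊥ → ∃ x ∈ J, lam x ≠ 0)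
    (I E : Type) [DecidableEq I] [Fintype I] [Fintype E] (s t : E → I)
    (α : I → ℕ) (ζ : k) (hζ : IsPrimitiveRoot ζ (∑ i, α i)) :
    aOrbitsPreproj k I E s t α R = aOrbits k I E s t α (DualNumber R) := by
  classical
  have hfin : Finite R := Module.finite_of_finite k
  have hfin' : Finite (DualNumber R) := inferInstanceAs (Finite (R × R))
  have : Fintype (QGl I α R) := Fintype.ofFinite _
  have : Fintype (QGl I α (DualNumber R)) := Fintype.ofFinite _
  have : Fintype (QMat I α R) := Fintype.ofFinite _
  obtain ⟨ρ, hρ⟩ := exists_augmentation hsplit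
  obtain ⟨ψ, hψn, c, hc0, hc⟩ := exists_mulChar_of_isPrimitiveRoot hζ
  have hn := natCast_ne_zero_of_isPrimitiveRoot hζ
  have h1 := card_absInd_orbits_mul_card ρ hρ ψ hn hψn c hc0 hc
    (fun N : QRep I (E ⊕ E) (Sum.elim s t) (Sum.elim t s) α R =>
      ∀ i, momentMapD I E s t α R N i = 0)
    (fun g N hN i => by rw [momentMapD_QAct, hN, mul_zero, zero_mul])
  have h2 := card_absInd_orbits_mul_card (dualNumberAug ρ)
    (isNilpotent_of_dualNumberAug_eq_zero ρ hρ) ψ hn hψn c hc0 hc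
    (fun _ : QRep I E s t α (DualNumber R) => True) (fun _ _ _ => trivial)
  simp only [true_and] at h2
  have h3 : ∑ g : QGl I α (DualNumber R), detChar (dualNumberAug ρ) ψ g *
        (Nat.card {X : QRep I E s t α (DualNumber R) // QAct s t α g X = X} : ℂ) =
      Nat.card (QMat I α R) * ∑ g : QGl I α R, detChar ρ ψ g *
        (Nat.card {N : QRep I (E ⊕ E) (Sum.elim s t) (Sum.elim t s) α R //
          (∀ i, momentMapD I E s t α R N i = 0) ∧
            QAct (Sum.elim s t) (Sum.elim t s) α g N = N} : ℂ) := by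
    rw [Finset.mul_sum]
    have h4 : ∀ g : QGl I α (DualNumber R), detChar (dualNumberAug ρ) ψ g *
        (Nat.card {X : QRep I E s t α (DualNumber R) // QAct s t α g X = X} : ℂ) =
        detChar ρ ψ (QGl.dualNumberEquiv g).1 *
        (Nat.card {Z : QRep I E s t α R × QRep I E s t α R //
          QAct s t α (QGl.dualNumberEquiv g).1 Z.1 = Z.1 ∧
          deformMap k (fun i => ((QGl.dualNumberEquiv g).1 i).val) Z.1
            ((QGl.dualNumberEquiv g).2, Z.2) = 0} : ℂ) := by
      intro g
      congr 1
      exact congrArg Nat.cast (Nat.card_congr (QRep.dualNumberEquiv.subtypeEquiv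
        (QAct_dualNumber_iff k g (QGl.dualNumberEquiv g).1 fun _ => rfl)))
    rw [Finset.sum_congr rfl fun g _ => h4 g, QGl.dualNumberEquiv.sum_comp
      fun w : QGl I α R × QMat I α R => detChar ρ ψ w.1 *
        (Nat.card {Z : QRep I E s t α R × QRep I E s t α R //
          QAct s t α w.1 Z.1 = Z.1 ∧
          deformMap k (fun i => (w.1 i).val) Z.1 (w.2, Z.2) = 0} : ℂ), Fintype.sum_prod_type]
    refine Finset.sum_congr rfl fun g _ => ?_
    simp only
    rw [← Finset.mul_sum, mul_left_comm, ← Nat.cast_mul, ← card_sigma_deform_eq lam hlam g,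
      Nat.card_sigma, Nat.cast_sum]
  have h5 : Nat.card (QGl I α (DualNumber R)) = Nat.card (QGl I α R) * Nat.card (QMat I α R) := by
    rw [Nat.card_congr QGl.dualNumberEquiv, Nat.card_prod]
  rw [h3, ← h1, h5] at h2
  have h6 : (Nat.card (QGl I α R) : ℂ) ≠ 0 := Nat.cast_ne_zero.mpr Nat.card_pos.ne'
  have h7 : (Nat.card (QMat I α R) : ℂ) ≠ 0 := Nat.cast_ne_zero.mpr Nat.card_pos.ne'
  rw [aOrbitsPreproj, aOrbits, ← Nat.cast_inj (R := ℂ)]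
  push_cast at h2
  apply mul_right_cancel₀ (mul_ne_zero h6 h7)
  rw [h2]
  ring
end

section
/- Let k be an algebraically closed field and R a local Frobenius k-algebra. Let d be a positive integer and suppose the set of orbits of the multiplication action of the unit group R× on R is finite of cardinality d + 1 (equivalently, R has exactly d + 1 distinct principal ideals). Then R is isomorphic as a k-algebra to k[t]/(t^d). -/
open Polynomial

/-- A ring over an infinite field with finitely many orbits of the unit group is Bézout. -/
theorem isBezout_of_finite_unit_orbits {k R : Type*} [Field k] [Infinite k] [CommRing R]
    [Algebra k R] [Finite {O : Set R // ∃ a : R, O = {b | ∃ u : Rˣ, b = (u : R) * a}}] :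
    IsBezout R := by
  rw [IsBezout.iff_span_pair_isPrincipal]
  intro x y
  let f : k → {O : Set R // ∃ a : R, O = {b | ∃ u : Rˣ, b = (u : R) * a}} := fun c =>
    ⟨{b | ∃ u : Rˣ, b = (u : R) * (x + algebraMap k R c * y)}, _, rfl⟩
  obtain ⟨c, c', hne, h⟩ := Finite.exists_ne_map_eq_of_infinite f
  have hmem : x + algebraMap k R c * y ∈
      {b | ∃ u : Rˣ, b = (u : R) * (x + algebraMap k R c' * y)} := by
    refine (congrArg Subtype.val h).subset ?_
    exact ⟨1, by simp⟩
  obtain ⟨u, hu⟩ := hmem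
  set z := x + algebraMap k R c' * y with hz
  have hinv : algebraMap k R (c - c')⁻¹ * (algebraMap k R c - algebraMap k R c') = 1 := by
    rw [← map_sub, ← map_mul, inv_mul_cancel₀ (sub_ne_zero.2 hne), map_one]
  have hy : z ∣ y :=
    ⟨algebraMap k R (c - c')⁻¹ * (u - 1), by
      linear_combination (-y) * hinv + algebraMap k R (c - c')⁻¹ * (hu - hz)⟩
  have hx : z ∣ x := by
    have := dvd_sub (dvd_refl z) (hy.mul_left (algebraMap k R c'))
    rwa [hz, add_sub_cancel_right] at this
  refine ⟨z, le_antisymm ?_ ?_⟩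
  · rw [Ideal.span_le]
    rintro w (rfl | rfl)
    exacts [Ideal.mem_span_singleton.2 hx, Ideal.mem_span_singleton.2 hy]
  · refine (Ideal.span_singleton_le_iff_mem _).2 ?_
    exact add_mem (Ideal.subset_span (by simp))
      (Ideal.mul_mem_left _ _ (Ideal.subset_span (by simp)))

section Uniformizer

variable {R : Type*} [CommRing R] [IsLocalRing R] {t : R}

theorem dvd_of_not_isUnit_of_maximalIdeal_eq_span
    (ht : IsLocalRing.maximalIdeal R = Ideal.span {t}) {b : R} (hb : ¬ IsUnit b) : t ∣ b := by
  rwa [← Ideal.mem_span_singleton, ← ht, IsLocalRing.mem_maximalIdeal]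

theorem pow_dvd_or_exists_eq_unit_mul_pow
    (ht : IsLocalRing.maximalIdeal R = Ideal.span {t}) (a : R) (i : ℕ) :
    t ^ i ∣ a ∨ ∃ j < i, ∃ u : Rˣ, a = u * t ^ j := by
  induction i with
  | zero => simp
  | succ i ih =>
    rcases ih with ⟨b, rfl⟩ | ⟨j, hj, u, hu⟩
    · by_cases hb : IsUnit b
      · exact Or.inr ⟨i, i.lt_succ_self, hb.unit, by simp [mul_comm]⟩
      · rw [pow_succ]
        exact Or.inl (mul_dvd_mul_left _ (dvd_of_not_isUnit_of_maximalIdeal_eq_span ht hb))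
    · exact Or.inr ⟨j, hj.trans i.lt_succ_self, u, hu⟩

theorem pow_eq_zero_of_eq_mul_pow (htu : ¬ IsUnit t) {i j : ℕ} (hij : i < j) {u : R}
    (h : t ^ i = u * t ^ j) : t ^ i = 0 := by
  obtain ⟨e, rfl⟩ := Nat.exists_eq_add_of_lt hij
  have hunit : IsUnit (1 - u * t ^ e * t) := by
    refine (IsLocalRing.isUnit_or_isUnit_one_sub_self (u * t ^ e * t)).resolve_left fun h' => ?_
    exact htu (isUnit_of_mul_isUnit_right h')
  exact hunit.mul_left_eq_zero.1 (by linear_combination h)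

/-- In a local ring whose maximal ideal is generated by an element of nilpotency class `n`,
the orbits of the unit group are those of `t ^ i` for `i ≤ n`. -/
theorem card_unit_orbits_of_maximalIdeal_eq_span
    (ht : IsLocalRing.maximalIdeal R = Ideal.span {t}) {n : ℕ} (hn : t ^ n = 0)
    (hmin : ∀ i < n, t ^ i ≠ 0) :
    Nat.card {O : Set R // ∃ a : R, O = {b | ∃ u : Rˣ, b = (u : R) * a}} = n + 1 := by
  have htu : ¬ IsUnit t := by
    rw [← mem_nonunits_iff, ← IsLocalRing.mem_maximalIdeal, ht]
    exact Ideal.mem_span_singleton_self t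
  let f : Fin (n + 1) → {O : Set R // ∃ a : R, O = {b | ∃ u : Rˣ, b = (u : R) * a}} :=
    fun i => ⟨{b | ∃ u : Rˣ, b = (u : R) * t ^ (i : ℕ)}, _, rfl⟩
  have hle : ∀ i j : Fin (n + 1), f i = f j → j ≤ i := by
    intro i j h
    by_contra! hij
    have hmem : t ^ (i : ℕ) ∈ {b | ∃ u : Rˣ, b = (u : R) * t ^ (j : ℕ)} := by
      refine (congrArg Subtype.val h).subset ?_
      exact ⟨1, by simp⟩
    obtain ⟨u, hu⟩ := hmem
    exact hmin i (by omega) (pow_eq_zero_of_eq_mul_pow htu hij hu)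
  have hbij : Function.Bijective f := by
    refine ⟨fun i j h => le_antisymm (hle j i h.symm) (hle i j h), ?_⟩
    rintro ⟨_, a, rfl⟩
    obtain ⟨j, hj, v, rfl⟩ : ∃ j ≤ n, ∃ v : Rˣ, a = v * t ^ j := by
      rcases pow_dvd_or_exists_eq_unit_mul_pow ht a n with h | ⟨j, hj, v, hv⟩
      · exact ⟨n, le_rfl, 1, by rw [hn, zero_dvd_iff] at h; simp [h, hn]⟩
      · exact ⟨j, hj.le, v, hv⟩
    refine ⟨⟨j, by omega⟩, Subtype.ext (Set.ext fun b => ⟨?_, ?_⟩)⟩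
    · rintro ⟨u, rfl⟩
      exact ⟨u * v⁻¹, by simp [mul_assoc]⟩
    · rintro ⟨u, rfl⟩
      exact ⟨u * v, by simp [mul_assoc]⟩
  rw [← Nat.card_congr (Equiv.ofBijective f hbij), Nat.card_fin]

variable {k : Type*} [Field k] [Algebra k R]

theorem aeval_surjective_of_maximalIdeal_eq_span
    (ht : IsLocalRing.maximalIdeal R = Ideal.span {t}) {n : ℕ} (hn : t ^ n = 0)
    (hres : Function.Surjective (algebraMap k (IsLocalRing.ResidueField R))) :
    Function.Surjective (aeval t : k[X] →ₐ[k] R) := by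
  have step : ∀ i : ℕ, ∀ r : R, ∃ p : k[X], t ^ i ∣ r - aeval t p := by
    intro i
    induction i with
    | zero => simp
    | succ i ih =>
      intro r
      obtain ⟨p, s, hs⟩ := ih r
      obtain ⟨c, hc⟩ := hres (IsLocalRing.residue R s)
      have hmem : s - algebraMap k R c ∈ IsLocalRing.maximalIdeal R := by
        rw [← IsLocalRing.residue_eq_zero_iff, map_sub, ← hc, sub_eq_zero]
        rfl
      rw [ht, Ideal.mem_span_singleton] at hmem
      obtain ⟨w, hw⟩ := hmem
      refine ⟨p + C c * X ^ i, w, ?_⟩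
      simp only [map_add, map_mul, aeval_C, map_pow, aeval_X]
      linear_combination hs + t ^ i * hw
  intro r
  obtain ⟨p, hp⟩ := step n r
  rw [hn, zero_dvd_iff, sub_eq_zero] at hp
  exact ⟨p, hp.symm⟩

theorem ker_aeval_eq_span_X_pow (htu : ¬ IsUnit t) {n : ℕ} (hn : t ^ n = 0)
    (hmin : ∀ i < n, t ^ i ≠ 0) :
    RingHom.ker (aeval t : k[X] →ₐ[k] R) = Ideal.span {(X : k[X]) ^ n} := by
  refine le_antisymm (fun p hp => ?_) ?_
  · rw [Ideal.mem_span_singleton]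
    rw [RingHom.mem_ker] at hp
    by_cases hp0 : p = 0
    · simp [hp0]
    obtain ⟨q, hq, hndvd⟩ := exists_eq_pow_rootMultiplicity_mul_and_not_dvd p hp0 0
    rw [C_0, sub_zero] at hq hndvd
    have hunit : IsUnit (aeval t q) := by
      by_contra hnu
      have hc : q.coeff 0 ≠ 0 := fun h => hndvd (X_dvd_iff.2 h)
      have hcu : IsUnit (algebraMap k R (q.coeff 0)) := (IsUnit.mk0 _ hc).map _
      have hdecomp : aeval t q = aeval t q.divX * t + algebraMap k R (q.coeff 0) := by
        conv_lhs => rw [← divX_mul_X_add q]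
        simp
      have hsub : algebraMap k R (q.coeff 0) = aeval t q - aeval t q.divX * t := by
        rw [hdecomp]; ring
      refine (IsLocalRing.mem_maximalIdeal _).1 ?_ hcu
      rw [hsub]
      exact sub_mem ((IsLocalRing.mem_maximalIdeal _).2 hnu)
        (Ideal.mul_mem_left _ _ ((IsLocalRing.mem_maximalIdeal _).2 htu))
    rw [hq, map_mul, map_pow, aeval_X, hunit.mul_left_eq_zero] at hp
    rw [hq]
    exact (pow_dvd_pow _ (not_lt.1 fun h => hmin _ h hp)).mul_right _
  · rw [Ideal.span_singleton_le_iff_mem, RingHom.mem_ker]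
    simp [hn]

end Uniformizer

/-- Let `k` be an algebraically closed field and `R` a local Frobenius `k`-algebra.  If the
set of orbits of the multiplication action of `R×` on `R` is finite of cardinality `d + 1`
(with `d ≥ 1`), then `R ≅ k[t]/(t^d)` as a `k`-algebra. -/
theorem local_frobenius_with_finitely_many_principal_ideals_is_truncated_polynomial_ring
    (k : Type) [Field k] [IsAlgClosed k]
    (R : Type) [CommRing R] [Algebra k R] [FiniteDimensional k R] [IsLocalRing R]
    (lam : R →ₗ[k] k) (hlam : ∀ J : Ideal R, J ≠ ⊥ → ∃ x ∈ J, lam x ≠ 0)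
    (d : ℕ) (hd : 0 < d)
    (horb : Nat.card {O : Set R // ∃ a : R, O = {b | ∃ u : Rˣ, b = (u : R) * a}} = d + 1) :
    Nonempty (R ≃ₐ[k] (Polynomial k ⧸ Ideal.span {(X : Polynomial k) ^ d})) := by
  classical
  have hfin : Finite {O : Set R // ∃ a : R, O = {b | ∃ u : Rˣ, b = (u : R) * a}} :=
    Nat.finite_of_card_ne_zero (by omega)
  have hbez : IsBezout R := isBezout_of_finite_unit_orbits (k := k)
  have hart : IsArtinianRing R := IsArtinianRing.of_finite k R
  obtain ⟨t, ht⟩ : ∃ t, IsLocalRing.maximalIdeal R = Ideal.span {t} :=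
    (IsBezout.isPrincipal_of_FG _ (IsNoetherian.noetherian _)).principal
  have htm : t ∈ IsLocalRing.maximalIdeal R := ht ▸ Ideal.mem_span_singleton_self t
  have hnil : ∃ n, t ^ n = 0 := by
    obtain ⟨n, hn⟩ := IsArtinianRing.isNilpotent_jacobson_bot (R := R)
    rw [IsLocalRing.jacobson_eq_maximalIdeal _ bot_ne_top] at hn
    exact ⟨n, by simpa [hn] using Ideal.pow_mem_pow htm n⟩
  have hmin : ∀ i < Nat.find hnil, t ^ i ≠ 0 := fun i hi => Nat.find_min hnil hi
  have hcard := card_unit_orbits_of_maximalIdeal_eq_span ht (Nat.find_spec hnil) hmin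
  obtain rfl : Nat.find hnil = d := by omega
  have hres : Function.Surjective (algebraMap k (IsLocalRing.ResidueField R)) :=
    (IsAlgClosed.algebraMap_bijective_of_isIntegral).2
  exact ⟨((Ideal.quotientEquivAlgOfEq k
    (ker_aeval_eq_span_X_pow ((IsLocalRing.mem_maximalIdeal _).1 htm)
      (Nat.find_spec hnil) hmin).symm).trans
    (Ideal.quotientKerAlgEquivOfSurjective
      (aeval_surjective_of_maximalIdeal_eq_span ht (Nat.find_spec hnil) hres))).symm⟩
end

section
/- Let k be a field, d > 1 an integer, and R = k[t]/(t^d). For λ ∈ k let e_λ = (1, λ·t^{d−1}) ∈ R², regarded as a column vector. Suppose A ∈ GL₂(R) satisfies A·e₀ = μ₀·e₀ and A·e₁ = μ₁·e₁ for some units μ₀, μ₁ ∈ R×. Then for every λ ∈ k there exists a unit μ_λ ∈ R× such that A·e_λ = μ_λ·e_λ. -/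
open Polynomial Matrix

/-- The vector `e_λ = (1, λ t^{d-1})` in `R²`, `R = k[t]/(t^d)`. -/
noncomputable def eVec (k : Type) [Field k] (d : ℕ) (lamb : k) :
    Fin 2 → (Polynomial k ⧸ Ideal.span {(X : Polynomial k) ^ d}) :=
  ![1, algebraMap k _ lamb * (Ideal.Quotient.mk (Ideal.span {(X : Polynomial k) ^ d}) X) ^ (d - 1)]

/-- If `s ^ 2 = 0` and the matrix `M` has `(1, 0)` and `(1, s)` as eigenvectors with eigenvalues
`u` (a unit) and `v`, then `(1, c * s)` is an eigenvector with unit eigenvalue for every `c`. -/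
theorem exists_unit_mulVec_eq_of_sq_eq_zero {R : Type*} [CommRing R] {s : R} (hs : s * s = 0)
    (M : Matrix (Fin 2) (Fin 2) R) (u : Rˣ) (v : R)
    (h0 : M.mulVec ![1, 0] = fun i => u.val * ![1, 0] i)
    (h1 : M.mulVec ![1, s] = fun i => v * ![1, s] i) (c : R) :
    ∃ w : Rˣ, M.mulVec ![1, c * s] = fun i => w.val * ![1, c * s] i := by
  have h00 := congrFun h0 0
  have h01 := congrFun h0 1
  have h10 := congrFun h1 0
  have h11 := congrFun h1 1
  simp only [Matrix.mulVec, dotProduct, Fin.sum_univ_two, Matrix.cons_val_zero,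
    Matrix.cons_val_one, mul_one, mul_zero, add_zero] at h00 h01 h10 h11
  have hnil : IsNilpotent (c * M 0 1 * s) := ⟨2, by linear_combination (c * M 0 1) ^ 2 * hs⟩
  obtain ⟨w, hw⟩ := hnil.isUnit_add_left_of_commute u.isUnit (Commute.all _ _)
  refine ⟨w, funext fun i => ?_⟩
  rw [hw]
  fin_cases i
  · simp [Matrix.mulVec, dotProduct, Fin.sum_univ_two]
    linear_combination h00
  · simp [Matrix.mulVec, dotProduct, Fin.sum_univ_two]
    linear_combination (1 - c) * h01 + c * h11 - c * s * h10 + c * s * h00 +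
      (c * M 0 1 - c ^ 2 * M 0 1) * hs

/-- Let `R = k[t]/(t^d)` with `d > 1` and `e_λ = (1, λ t^{d-1}) ∈ R²`.  If `A ∈ GL₂(R)`
satisfies `A e₀ = μ₀ e₀` and `A e₁ = μ₁ e₁` for units `μ₀, μ₁ ∈ R×`, then for every `λ ∈ k`
there is a unit `μ_λ ∈ R×` with `A e_λ = μ_λ e_λ`. -/
theorem eigenvector_family_of_two_eigenvectors
    (k : Type) [Field k] (d : ℕ) (hd : 1 < d)
    (A : (Matrix (Fin 2) (Fin 2) (Polynomial k ⧸ Ideal.span {(X : Polynomial k) ^ d}))ˣ)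
    (μ₀ μ₁ : (Polynomial k ⧸ Ideal.span {(X : Polynomial k) ^ d})ˣ)
    (h0 : (A : Matrix (Fin 2) (Fin 2) _).mulVec (eVec k d 0) = fun i => μ₀.val * eVec k d 0 i)
    (h1 : (A : Matrix (Fin 2) (Fin 2) _).mulVec (eVec k d 1) = fun i => μ₁.val * eVec k d 1 i) :
    ∀ lamb : k, ∃ μ : (Polynomial k ⧸ Ideal.span {(X : Polynomial k) ^ d})ˣ,
      (A : Matrix (Fin 2) (Fin 2) _).mulVec (eVec k d lamb) = fun i => μ.val * eVec k d lamb i := by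
  have hs : (Ideal.Quotient.mk (Ideal.span {(X : Polynomial k) ^ d}) X) ^ (d - 1) *
      (Ideal.Quotient.mk (Ideal.span {(X : Polynomial k) ^ d}) X) ^ (d - 1) = 0 := by
    rw [← pow_add, ← map_pow, Ideal.Quotient.eq_zero_iff_mem, Ideal.mem_span_singleton]
    exact pow_dvd_pow _ (by omega)
  intro lamb
  refine exists_unit_mulVec_eq_of_sq_eq_zero hs A.val μ₀ μ₁.val ?_ ?_ (algebraMap k _ lamb)
  · simpa only [eVec, map_zero, zero_mul] using h0
  · simpa only [eVec, map_one, one_mul] using h1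
end

section
/- Let k be a field, d > 1 an integer, and R = k[t]/(t^d). For λ ∈ k let e_λ = (1, λ·t^{d−1}) ∈ R², regarded as a column vector. If λ₁, λ₂ ∈ k and there exist A ∈ GL₂(R) and units u₀, u₁, u₂ ∈ R× such that A·e₀ = u₀·e₀, A·e₁ = u₁·e₁, and A·e_{λ₁} = u₂·e_{λ₂}, then λ₁ = λ₂. (Consequently, for k infinite, the rank-(2,1,1,1) locally free representations of the D₄ quiver over R determined by the triples of vectors (e₀, e₁, e_λ) are pairwise non-isomorphic, so D₄ has infinitely many non-isomorphic locally free indecomposable representations over k[t]/(t^d) for d > 1.) -/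
open Polynomial Matrix

/-- Let `R = k[t]/(t^d)` with `d > 1` and `e_λ = (1, λ t^{d-1}) ∈ R²`.  If some `A ∈ GL₂(R)`
fixes the lines spanned by `e₀` and `e₁` (i.e. `A e₀ = u₀ e₀`, `A e₁ = u₁ e₁` for units
`u₀, u₁`) and maps `e_{λ₁}` to a unit multiple of `e_{λ₂}`, then `λ₁ = λ₂`.  (Hence for
infinite `k` the rank `(2,1,1,1)` representations of the `D₄` quiver given by the triples
`(e₀, e₁, e_λ)` are pairwise non-isomorphic, so `D₄` has infinitely many non-isomorphic
locally free indecomposable representations over `k[t]/(t^d)` for `d > 1`.) -/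
theorem eVec_unit_multiple_injective
    (k : Type) [Field k] (d : ℕ) (hd : 1 < d)
    (lamb₁ lamb₂ : k)
    (A : (Matrix (Fin 2) (Fin 2) (Polynomial k ⧸ Ideal.span {(X : Polynomial k) ^ d}))ˣ)
    (u₀ u₁ u₂ : (Polynomial k ⧸ Ideal.span {(X : Polynomial k) ^ d})ˣ)
    (h0 : (A : Matrix (Fin 2) (Fin 2) _).mulVec (eVec k d 0) = fun i => u₀.val * eVec k d 0 i)
    (h1 : (A : Matrix (Fin 2) (Fin 2) _).mulVec (eVec k d 1) = fun i => u₁.val * eVec k d 1 i)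
    (h2 : (A : Matrix (Fin 2) (Fin 2) _).mulVec (eVec k d lamb₁) =
      fun i => u₂.val * eVec k d lamb₂ i) :
    lamb₁ = lamb₂ := by
  set s := (Ideal.Quotient.mk (Ideal.span {(X : Polynomial k) ^ d}) X) ^ (d - 1) with hs
  have hss : s * s = 0 := by
    rw [hs, ← pow_add, ← map_pow]
    exact Ideal.Quotient.eq_zero_iff_mem.mpr
      (Ideal.mem_span_singleton.mpr (pow_dvd_pow X (by omega)))
  have h00 := congrFun h0 0
  have h01 := congrFun h0 1
  have h10 := congrFun h1 0
  have h11 := congrFun h1 1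
  have h20 := congrFun h2 0
  have h21 := congrFun h2 1
  simp only [eVec, Matrix.mulVec, dotProduct, Fin.sum_univ_two, Matrix.cons_val_zero,
    Matrix.cons_val_one, map_zero, map_one, zero_mul, mul_zero, add_zero, mul_one, one_mul,
    ← hs] at h00 h01 h10 h11 h20 h21
  have key : u₀.val * (algebraMap k _ (lamb₁ - lamb₂) * s) = 0 := by
    rw [map_sub]
    rw [h01, ← h10, h00] at h11
    rw [h01, ← h20, h00] at h21
    linear_combination h21 - algebraMap k _ lamb₁ * h11 +
      ((A : Matrix (Fin 2) (Fin 2) _) 0 1 * algebraMap k _ lamb₁ *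
        (algebraMap k _ lamb₂ - 1)) * hss
  have hz := (Units.mul_right_eq_zero u₀).mp key
  have hmem : C (lamb₁ - lamb₂) * X ^ (d - 1) ∈ Ideal.span {(X : Polynomial k) ^ d} := by
    rw [← Ideal.Quotient.eq_zero_iff_mem, map_mul, map_pow]
    exact hz
  have hcoeff := X_pow_dvd_iff.mp (Ideal.mem_span_singleton.mp hmem) (d - 1) (by omega)
  rw [coeff_C_mul_X_pow, if_pos rfl] at hcoeff
  exact sub_eq_zero.mp hcoeff
end
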